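/- arXiv:1412.0386 — 5 statements merged into one kernel-verified Lean document; each statement's English description precedes it below -/
import Mathlib

section
/- The geometric realization of the multiple chessboard complex Δ_{5,2}^{2,1} (a 5×2 chessboard with at most 2 rooks in each row and at most 1 rook in each column) is homeomorphic to the sphere S^3. -/
open scoped BigOperators

/-- A face of the multiple chessboard complex `Δ_{m,n}^{p,q}` (row capacities `k`,
column capacities `l`). -/
def IsFace (m n : ℕ) (k : Fin n → ℕ) (l : Fin m → ℕ)
    (A : Finset (Fin m × Fin n)) : Prop :=
  (∀ i : Fin n, (A.filter fun v => v.2 = i).card ≤ k i) ∧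
  (∀ j : Fin m, (A.filter fun v => v.1 = j).card ≤ l j)

/-- The geometric realization of the multiple chessboard complex. -/
def Realization (m n : ℕ) (k : Fin n → ℕ) (l : Fin m → ℕ) :
    Set ((Fin m × Fin n) → ℝ) :=
  {f | (∀ v, 0 ≤ f v ∧ f v ≤ 1) ∧ ∑ v, f v = 1 ∧
      IsFace m n k l (Finset.univ.filter fun v => 0 < f v)}

open scoped Finset

/-- At most two entries are positive and at most two are negative; equivalently, `0` is the
median of the five entries. -/
def IsBalanced (x : Fin 5 → ℝ) : Prop :=
  #{j | 0 < x j} ≤ 2 ∧ #{j | x j < 0} ≤ 2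

/-- The median of five real numbers. -/
noncomputable def median (y : Fin 5 → ℝ) : ℝ :=
  Finset.univ.sup' ⟨⟨{0, 1, 2}, rfl⟩, Finset.mem_univ _⟩
    fun s : {s : Finset (Fin 5) // s.card = 3} =>
      s.1.inf' (Finset.card_pos.1 (by rw [s.2]; norm_num)) y

lemma continuous_median : Continuous median := by
  unfold median
  refine Continuous.finset_sup'_apply _ fun s _ => ?_
  exact Continuous.finset_inf'_apply _ fun j _ => continuous_apply j

lemma isBalanced_sub_median (y : Fin 5 → ℝ) : IsBalanced fun j => y j - median y := by
  constructor
  · by_contra! h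
    obtain ⟨s, hs, hcard⟩ := Finset.exists_subset_card_eq (Nat.succ_le_of_lt h)
    have hle : s.inf' (Finset.card_pos.1 (by omega)) y ≤ median y :=
      Finset.le_sup' (fun s : {s : Finset (Fin 5) // s.card = 3} =>
        s.1.inf' (Finset.card_pos.1 (by rw [s.2]; norm_num)) y)
        (Finset.mem_univ (⟨s, hcard⟩ : {s : Finset (Fin 5) // s.card = 3}))
    obtain ⟨j, hj, hj'⟩ := (Finset.inf'_le_iff _).1 hle
    have := (Finset.mem_filter.1 (hs hj)).2
    linarith
  · obtain ⟨s, -, hs⟩ := Finset.exists_mem_eq_sup' (s := Finset.univ)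
      ⟨⟨{0, 1, 2}, rfl⟩, Finset.mem_univ _⟩
      fun s : {s : Finset (Fin 5) // s.card = 3} =>
        s.1.inf' (Finset.card_pos.1 (by rw [s.2]; norm_num)) y
    change median y = _ at hs
    have hsub : (Finset.univ.filter fun j => y j - median y < 0) ⊆ s.1ᶜ := by
      intro j hj
      rw [Finset.mem_compl]
      intro hjs
      have h1 := (Finset.mem_filter.1 hj).2
      have h2 := Finset.inf'_le y hjs
      linarith
    have := Finset.card_le_card hsub
    rwa [Finset.card_compl, s.2, Fintype.card_fin] at this

lemma IsBalanced.const_mul {x : Fin 5 → ℝ} (hx : IsBalanced x) {c : ℝ} (hc : 0 < c) :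
    IsBalanced fun j => c * x j := by
  have hneg : ∀ t : ℝ, c * t < 0 ↔ t < 0 := fun t => by simp [mul_neg_iff, hc, hc.not_gt]
  simpa only [IsBalanced, mul_pos_iff_of_pos_left hc, hneg] using hx

lemma nonneg_of_card_pos_le_of_card_add_neg_le {x : Fin 5 → ℝ} {c : ℝ} (hx : #{j | 0 < x j} ≤ 2)
    (hxc : #{j | x j + c < 0} ≤ 2) : 0 ≤ c := by
  by_contra! hc
  have hcover : (Finset.univ : Finset (Fin 5)) ⊆
      (Finset.univ.filter fun j => 0 < x j) ∪ Finset.univ.filter fun j => x j + c < 0 := by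
    intro j _
    rcases lt_or_ge 0 (x j) with h | h
    · simp [h]
    · simp [show x j + c < 0 by linarith]
  have h1 := (Finset.card_le_card hcover).trans (Finset.card_union_le _ _)
  rw [Finset.card_univ, Fintype.card_fin] at h1
  omega

lemma IsBalanced.eq_of_sub_eq {x y : Fin 5 → ℝ} (hx : IsBalanced x) (hy : IsBalanced y)
    {c : ℝ} (h : ∀ j, y j = x j + c) : y = x := by
  have h1 : 0 ≤ c := nonneg_of_card_pos_le_of_card_add_neg_le hx.1 (by simpa only [← h] using hy.2)
  have h2 : 0 ≤ -c := nonneg_of_card_pos_le_of_card_add_neg_le hy.1 (by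
    simpa only [h, add_neg_cancel_right] using hx.2)
  ext j
  rw [h, show c = 0 by linarith, add_zero]

lemma IsBalanced.eq_zero_of_const {x : Fin 5 → ℝ} (hx : IsBalanced x) {c : ℝ}
    (h : ∀ j, x j = c) : x = 0 :=
  IsBalanced.eq_of_sub_eq (x := 0) (by simp [IsBalanced]) hx (c := c) (by simpa using h)

/-- The signed column weights of a point of the `5 × 2` chessboard. -/
def signedWeight (f : Fin 5 × Fin 2 → ℝ) (j : Fin 5) : ℝ := f (j, 0) - f (j, 1)

/-- The positive and negative parts of a vector, as weights on the `5 × 2` chessboard. -/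
def signParts (x : Fin 5 → ℝ) (v : Fin 5 × Fin 2) : ℝ :=
  if v.2 = 0 then max (x v.1) 0 else max (-x v.1) 0

lemma signedWeight_signParts (x : Fin 5 → ℝ) : signedWeight (signParts x) = x := by
  ext j
  simp only [signedWeight, signParts, if_true, one_ne_zero, if_false]
  rcases le_total 0 (x j) with h | h <;> simp [h]

lemma signParts_sum (x : Fin 5 → ℝ) : ∑ v, signParts x v = ∑ j, |x j| := by
  rw [Fintype.sum_prod_type]
  refine Finset.sum_congr rfl fun j _ => ?_
  simp only [Fin.sum_univ_two, signParts, if_true, one_ne_zero, if_false]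
  rcases le_total 0 (x j) with h | h <;> simp [h, abs_of_nonneg, abs_of_nonpos]

lemma signParts_nonneg (x : Fin 5 → ℝ) (v : Fin 5 × Fin 2) : 0 ≤ signParts x v := by
  unfold signParts
  split_ifs <;> exact le_max_right _ _

lemma continuous_signParts : Continuous signParts := by
  refine continuous_pi fun v => ?_
  unfold signParts
  split_ifs <;> fun_prop

lemma card_filter_snd (p : Fin 5 × Fin 2 → Prop) [DecidablePred p] (i : Fin 2) :
    ((Finset.univ.filter p).filter fun v => v.2 = i).card =
      (Finset.univ.filter fun j => p (j, i)).card := by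
  rw [← Finset.card_map (Function.Embedding.sectL (Fin 5) i)]
  congr 1
  ext ⟨a, b⟩
  simp only [Finset.mem_filter, Finset.mem_univ, true_and, Finset.mem_map,
    Function.Embedding.sectL_apply, Prod.mk.injEq]
  constructor
  · rintro ⟨h, rfl⟩
    exact ⟨a, h, rfl, rfl⟩
  · rintro ⟨j, h, rfl, rfl⟩
    exact ⟨h, rfl⟩

lemma signParts_mem {x : Fin 5 → ℝ} (hx : IsBalanced x) (hsum : ∑ j, |x j| = 1) :
    signParts x ∈ Realization 5 2 (fun _ => 2) fun _ => 1 := by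
  have hs : ∑ v, signParts x v = 1 := (signParts_sum x).trans hsum
  refine ⟨fun v => ⟨signParts_nonneg x v, ?_⟩, hs, fun i => ?_, fun j => ?_⟩
  · rw [← hs]
    exact Finset.single_le_sum (fun w _ => signParts_nonneg x w) (Finset.mem_univ v)
  · rw [card_filter_snd]
    fin_cases i
    · simpa [signParts] using hx.1
    · simpa [signParts] using hx.2
  · refine Finset.card_le_one.2 ?_
    rintro ⟨a, b⟩ hab ⟨c, d⟩ hcd
    simp only [Finset.mem_filter, Finset.mem_univ, true_and] at hab hcd
    obtain ⟨hb, rfl⟩ := hab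
    obtain ⟨hd, rfl⟩ := hcd
    fin_cases b <;> fin_cases d <;> simp [signParts] at hb hd ⊢ <;> linarith

lemma eq_zero_or_eq_zero_of_mem {f : Fin 5 × Fin 2 → ℝ}
    (hf : f ∈ Realization 5 2 (fun _ => 2) fun _ => 1) (j : Fin 5) :
    f (j, 0) = 0 ∨ f (j, 1) = 0 := by
  by_contra! h
  have h0 := lt_of_le_of_ne (hf.1 (j, 0)).1 h.1.symm
  have h1 := lt_of_le_of_ne (hf.1 (j, 1)).1 h.2.symm
  have := Finset.card_le_one.1 (hf.2.2.2 j) (j, 0) (by simp [h0]) (j, 1) (by simp [h1])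
  simp at this

lemma signParts_signedWeight {f : Fin 5 × Fin 2 → ℝ}
    (hf : f ∈ Realization 5 2 (fun _ => 2) fun _ => 1) :
    signParts (signedWeight f) = f := by
  ext ⟨j, i⟩
  have h0 := (hf.1 (j, 0)).1
  have h1 := (hf.1 (j, 1)).1
  rcases eq_zero_or_eq_zero_of_mem hf j with h | h <;> fin_cases i <;>
    simp [signParts, signedWeight, h, h0, h1]

lemma sum_abs_signedWeight {f : Fin 5 × Fin 2 → ℝ}
    (hf : f ∈ Realization 5 2 (fun _ => 2) fun _ => 1) :
    ∑ j, |signedWeight f j| = 1 := by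
  rw [← signParts_sum, signParts_signedWeight hf, hf.2.1]

lemma isBalanced_signedWeight {f : Fin 5 × Fin 2 → ℝ}
    (hf : f ∈ Realization 5 2 (fun _ => 2) fun _ => 1) :
    IsBalanced (signedWeight f) := by
  have key : ∀ i : Fin 2, #{j | 0 < f (j, i)} ≤ 2 := fun i => by
    simpa only [card_filter_snd] using hf.2.2.1 i
  refine ⟨(Finset.card_le_card ?_).trans (key 0), (Finset.card_le_card ?_).trans (key 1)⟩ <;>
  · intro j hj
    simp only [Finset.mem_filter, Finset.mem_univ, true_and] at hj ⊢
    unfold signedWeight at hj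
    linarith [(hf.1 (j, 0)).1, (hf.1 (j, 1)).1]

/-- The differences of the first four coordinates with the last one. -/
noncomputable def diffLast (x : Fin 5 → ℝ) : EuclideanSpace ℝ (Fin 4) :=
  WithLp.toLp 2 fun j => x j.castSucc - x (Fin.last 4)

lemma continuous_diffLast : Continuous diffLast := by
  unfold diffLast
  fun_prop

lemma diffLast_ne_zero {x : Fin 5 → ℝ} (hx : IsBalanced x) (hsum : ∑ j, |x j| = 1) :
    diffLast x ≠ 0 := by
  intro h
  have hc : ∀ j, x j = x (Fin.last 4) := by
    refine Fin.lastCases rfl fun j => ?_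
    have := congrArg (fun d : EuclideanSpace ℝ (Fin 4) => d j) h
    exact sub_eq_zero.1 this
  simp [hx.eq_zero_of_const hc] at hsum

/-- The representative with median zero of `(y, 0)` modulo constant vectors. -/
noncomputable def centered (y : EuclideanSpace ℝ (Fin 4)) (j : Fin 5) : ℝ :=
  (Fin.snoc y.ofLp 0 : Fin 5 → ℝ) j - median (Fin.snoc y.ofLp 0)

lemma isBalanced_centered (y : EuclideanSpace ℝ (Fin 4)) : IsBalanced (centered y) :=
  isBalanced_sub_median _

lemma continuous_centered : Continuous centered := by
  have h : Continuous fun y : EuclideanSpace ℝ (Fin 4) => (Fin.snoc y.ofLp 0 : Fin 5 → ℝ) := by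
    refine continuous_pi (Fin.lastCases ?_ fun j => ?_)
    · simp only [Fin.snoc_last]
      exact continuous_const
    · simp only [Fin.snoc_castSucc]
      fun_prop
  exact continuous_pi fun j => ((continuous_apply j).comp h).sub (continuous_median.comp h)

lemma diffLast_centered (y : EuclideanSpace ℝ (Fin 4)) : diffLast (centered y) = y := by
  ext j
  simp [diffLast, centered, -Fin.reduceLast]

lemma diffLast_smul (c : ℝ) (x : Fin 5 → ℝ) :
    diffLast (fun j => c * x j) = c • diffLast x := by
  ext j
  simp [diffLast, mul_sub]

lemma centered_smul_diffLast {x : Fin 5 → ℝ} (hx : IsBalanced x) {c : ℝ} (hc : 0 < c) :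
    centered (c • diffLast x) = fun j => c * x j := by
  refine (hx.const_mul hc).eq_of_sub_eq (isBalanced_centered _)
    (c := -(c * x (Fin.last 4)) - median (Fin.snoc (c • diffLast x).ofLp 0)) ?_
  refine Fin.lastCases ?_ fun j => ?_
  · simp [centered, -Fin.reduceLast]
    ring
  · simp [centered, diffLast, -Fin.reduceLast]
    ring

lemma sum_abs_centered_pos {y : EuclideanSpace ℝ (Fin 4)} (hy : y ≠ 0) :
    0 < ∑ j, |centered y j| := by
  refine lt_of_le_of_ne (Finset.sum_nonneg fun j _ => abs_nonneg _) fun h => hy ?_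
  have h0 : ∀ j, centered y j = 0 := fun j => abs_eq_zero.1
    ((Finset.sum_eq_zero_iff_of_nonneg fun j _ => abs_nonneg _).1 h.symm j (Finset.mem_univ j))
  rw [← diffLast_centered y]
  ext j
  simp [diffLast, h0]

/-- The centered representative of `y`, scaled to have `ℓ¹`-norm one. -/
noncomputable def normalizedCentered (y : EuclideanSpace ℝ (Fin 4)) (j : Fin 5) : ℝ :=
  (∑ i, |centered y i|)⁻¹ * centered y j

lemma normalizedCentered_smul_diffLast {x : Fin 5 → ℝ} (hx : IsBalanced x)
    (hsum : ∑ j, |x j| = 1) {c : ℝ} (hc : 0 < c) : normalizedCentered (c • diffLast x) = x := by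
  ext j
  simp only [normalizedCentered, centered_smul_diffLast hx hc, abs_mul, abs_of_pos hc,
    ← Finset.mul_sum, hsum]
  field_simp

lemma sum_abs_normalizedCentered {y : EuclideanSpace ℝ (Fin 4)} (hy : y ≠ 0) :
    ∑ j, |normalizedCentered y j| = 1 := by
  have h := sum_abs_centered_pos hy
  simp only [normalizedCentered, abs_mul, abs_inv, abs_of_pos h, ← Finset.mul_sum]
  exact inv_mul_cancel₀ h.ne'

lemma isBalanced_normalizedCentered {y : EuclideanSpace ℝ (Fin 4)} (hy : y ≠ 0) :
    IsBalanced (normalizedCentered y) :=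
  (isBalanced_centered y).const_mul (inv_pos.2 (sum_abs_centered_pos hy))

/-- The multiple chessboard complex `Δ_{5,2}^{2,1}` consists of the vectors of `ℝ⁵` with median
zero and `ℓ¹`-norm one; projecting along the constant vectors identifies it with the sphere. -/
noncomputable def realizationHomeomorphSphere :
    ↥(Realization 5 2 (fun _ => 2) fun _ => 1) ≃ₜ
      Metric.sphere (0 : EuclideanSpace ℝ (Fin 4)) 1 where
  toFun f := ⟨‖diffLast (signedWeight f)‖⁻¹ • diffLast (signedWeight f), by
    have h := diffLast_ne_zero (isBalanced_signedWeight f.2) (sum_abs_signedWeight f.2)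
    simpa using norm_smul_inv_norm (𝕜 := ℝ) h⟩
  invFun y := ⟨signParts (normalizedCentered y), by
    have hy := ne_zero_of_mem_unit_sphere y
    exact signParts_mem (isBalanced_normalizedCentered hy) (sum_abs_normalizedCentered hy)⟩
  left_inv f := by
    have hb := isBalanced_signedWeight f.2
    have hs := sum_abs_signedWeight f.2
    ext1
    change signParts (normalizedCentered (_ • diffLast (signedWeight f))) = f
    rw [normalizedCentered_smul_diffLast hb hs
      (inv_pos.2 (norm_pos_iff.2 (diffLast_ne_zero hb hs))), signParts_signedWeight f.2]
  right_inv y := by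
    have hpos := sum_abs_centered_pos (ne_zero_of_mem_unit_sphere y)
    have hd : diffLast (normalizedCentered y) = (∑ i, |centered y i|)⁻¹ • (y : _) := by
      rw [show normalizedCentered y = fun j => (∑ i, |centered y i|)⁻¹ * centered y j from rfl,
        diffLast_smul, diffLast_centered]
    ext1
    simp only [signedWeight_signParts, hd, norm_smul, norm_eq_of_mem_sphere, mul_one, norm_inv,
      Real.norm_of_nonneg hpos.le, inv_inv, smul_smul, mul_inv_cancel₀ hpos.ne', one_smul]
  continuous_toFun := by
    have hw : Continuous fun f : ↥(Realization 5 2 (fun _ => 2) fun _ => 1) =>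
        diffLast (signedWeight f) := by
      refine continuous_diffLast.comp (continuous_pi fun j => ?_)
      exact ((continuous_apply _).comp continuous_subtype_val).sub
        ((continuous_apply _).comp continuous_subtype_val)
    refine ((hw.norm.inv₀ fun f => ?_).smul hw).subtype_mk _
    exact norm_ne_zero_iff.2
      (diffLast_ne_zero (isBalanced_signedWeight f.2) (sum_abs_signedWeight f.2))
  continuous_invFun := by
    have hc : ∀ j, Continuous fun y : Metric.sphere (0 : EuclideanSpace ℝ (Fin 4)) 1 =>
        centered y j := fun j =>
      (continuous_apply j).comp (continuous_centered.comp continuous_subtype_val)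
    refine (continuous_signParts.comp (continuous_pi fun j => ?_)).subtype_mk _
    refine Continuous.mul (Continuous.inv₀ ?_ fun y => ?_) (hc j)
    · exact continuous_finsetSum _ fun i _ => (hc i).abs
    · exact (sum_abs_centered_pos (ne_zero_of_mem_unit_sphere y)).ne'

theorem delta_5_2_2_1_is_S3 :
    Nonempty (↥(Realization 5 2 (fun _ => 2) fun _ => 1) ≃ₜ
      Metric.sphere (0 : EuclideanSpace ℝ (Fin 4)) 1) :=
  ⟨realizationHomeomorphSphere⟩
end

section
/- The geometric realizations of the multiple chessboard complexes Δ_{3,3}^{2,1} and Δ_{4,3}^{2,1} are 1-connected, and the geometric realizations of Δ_{5,3}^{2,1} and Δ_{6,3}^{2,1} are 2-connected. -/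
open scoped BigOperators

/-- `c`-connectedness of a topological space, for `c : ℤ` (`(-1)`-connected means
nonempty): nonempty, path-connected when `c ≥ 0`, and trivial homotopy groups `π_i`
for `1 ≤ i ≤ c` at every basepoint. -/
def CConnected (c : ℤ) (X : Type) [TopologicalSpace X] : Prop :=
  Nonempty X ∧ (0 ≤ c → PathConnectedSpace X) ∧
  ∀ i : ℕ, 1 ≤ i → (i : ℤ) ≤ c → ∀ x : X, Subsingleton (HomotopyGroup (Fin i) X x)

namespace MultipleChessboard

open Set Topology Metric

section Spheres

/-- Every map into `X` from a sphere of dimension `< n` is null-homotopic.  The spheres are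
those of the sup norm, i.e. boundaries of cubes. -/
def SphereNull (n : ℕ) (X : Type*) [TopologicalSpace X] : Prop :=
  ∀ i < n, ∀ g : C(sphere (0 : Fin (i + 1) → ℝ) 1, X), g.Nullhomotopic

/-- The cone map from the cylinder over the unit sphere onto the closed unit ball. -/
def coneMap (E : Type*) [NormedAddCommGroup E] [NormedSpace ℝ E] :
    C(unitInterval × sphere (0 : E) 1, closedBall (0 : E) 1) where
  toFun p := ⟨(1 - (p.1 : ℝ)) • (p.2 : E), by
    have h1 : ‖(p.2 : E)‖ = 1 := by simp
    have h2 := p.1.2.1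
    have h3 := p.1.2.2
    rw [mem_closedBall_zero_iff, norm_smul, h1, mul_one, Real.norm_eq_abs, abs_le]
    constructor <;> linarith⟩
  continuous_toFun := by fun_prop

lemma isQuotientMap_coneMap (E : Type*) [NormedAddCommGroup E] [NormedSpace ℝ E]
    [FiniteDimensional ℝ E] [Nontrivial E] : IsQuotientMap (coneMap E) := by
  have : ProperSpace E := FiniteDimensional.proper_real E
  refine (coneMap E).continuous.isClosedMap.isQuotientMap (coneMap E).continuous ?_
  rintro ⟨y, hy⟩
  have hy' : ‖y‖ ≤ 1 := by simpa using hy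
  by_cases h : y = 0
  · obtain ⟨z, hz⟩ := NormedSpace.sphere_nonempty (x := (0 : E)) (r := 1) |>.2 zero_le_one
    exact ⟨(1, ⟨z, hz⟩), Subtype.ext (by simp [coneMap, h])⟩
  · have h' : ‖y‖ ≠ 0 := norm_ne_zero_iff.2 h
    refine ⟨(⟨1 - ‖y‖, by linarith, by linarith [norm_nonneg y]⟩,
      ⟨‖y‖⁻¹ • y, by simp [norm_smul, h']⟩), Subtype.ext ?_⟩
    simp [coneMap, smul_smul, h']

lemma exists_extension_of_nullhomotopic {E X : Type*} [NormedAddCommGroup E] [NormedSpace ℝ E]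
    [FiniteDimensional ℝ E] [Nontrivial E] [TopologicalSpace X] {g : C(sphere (0 : E) 1, X)}
    (hg : g.Nullhomotopic) :
    ∃ F : C(closedBall (0 : E) 1, X), ∀ y : sphere (0 : E) 1,
      F ⟨y, sphere_subset_closedBall y.2⟩ = g y := by
  obtain ⟨x, ⟨H⟩⟩ := hg
  have key : ∀ a b, coneMap E a = coneMap E b → H.toContinuousMap a = H.toContinuousMap b := by
    rintro ⟨t, y⟩ ⟨t', y'⟩ h
    have hy : ‖(y : E)‖ = 1 := by simp
    have hy' : ‖(y' : E)‖ = 1 := by simp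
    have h' : (1 - (t : ℝ)) • (y : E) = (1 - (t' : ℝ)) • (y' : E) := congrArg Subtype.val h
    have ht : (t : ℝ) = t' := by
      have := congrArg norm h'
      rw [norm_smul, norm_smul, hy, hy', Real.norm_eq_abs, Real.norm_eq_abs,
        abs_of_nonneg (by linarith [t.2.2]), abs_of_nonneg (by linarith [t'.2.2])] at this
      linarith
    obtain rfl : t = t' := Subtype.ext ht
    by_cases h1 : (t : ℝ) = 1
    · obtain rfl : t = 1 := Subtype.ext h1
      exact (H.apply_one y).trans (H.apply_one y').symm
    · have : (y : E) = y' := smul_right_injective E (sub_ne_zero.2 (Ne.symm h1)) h'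
      obtain rfl : y = y' := Subtype.ext this
      rfl
  refine ⟨(isQuotientMap_coneMap E).lift H.toContinuousMap key, fun y => ?_⟩
  have h := DFunLike.congr_fun
    ((isQuotientMap_coneMap E).lift_comp H.toContinuousMap key) ((0 : unitInterval), y)
  have h0 : coneMap E (0, y) = ⟨y, sphere_subset_closedBall y.2⟩ := by
    apply Subtype.ext
    simp [coneMap]
  rw [ContinuousMap.comp_apply, h0] at h
  exact h.trans (H.apply_zero y)

lemma SphereNull.joined {n : ℕ} {X : Type*} [TopologicalSpace X] (h : SphereNull n X)
    (hn : 0 < n) (x y : X) : Joined x y := by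
  have hdisc : ∀ p : sphere (0 : Fin 1 → ℝ) 1, p.1 0 ≠ 0 := by
    intro p hp
    have h1 : ‖(p : Fin 1 → ℝ)‖ = 1 := by simp
    have : (p : Fin 1 → ℝ) = 0 := by ext j; rw [Subsingleton.elim j 0, hp]; rfl
    simp [this] at h1
  let g : C(sphere (0 : Fin (0 + 1) → ℝ) 1, X) :=
    ⟨fun p => if p.1 0 ≤ 0 then x else y,
      Continuous.if_le continuous_const continuous_const ((continuous_apply 0).comp continuous_subtype_val) continuous_const
        fun p hp => absurd hp (hdisc p)⟩
  obtain ⟨F, hF⟩ := exists_extension_of_nullhomotopic (h 0 hn g)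
  have hm : ∀ t : unitInterval, (fun _ => 2 * (t : ℝ) - 1 : Fin (0 + 1) → ℝ) ∈ closedBall 0 1 := by
    intro t
    rw [mem_closedBall_zero_iff, pi_norm_le_iff_of_nonneg zero_le_one]
    intro _
    rw [Real.norm_eq_abs, abs_le]
    constructor <;> linarith [t.2.1, t.2.2]
  refine ⟨⟨⟨fun t => F ⟨fun _ => 2 * (t : ℝ) - 1, hm t⟩, by fun_prop⟩, ?_, ?_⟩⟩
  · have := hF ⟨fun _ => -1, by simp⟩
    simpa [g] using this
  · have := hF ⟨fun _ => 1, by simp⟩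
    norm_num [g] at this ⊢
    exact this

lemma SphereNull.genLoop_homotopic_const {n : ℕ} {X : Type*} [TopologicalSpace X]
    (h : SphereNull n X) {i : ℕ} (hi : i < n) (x : X) (f : GenLoop (Fin i) X x) :
    GenLoop.Homotopic f GenLoop.const := by
  let s : (Fin (i + 1) → ℝ) → Fin i → unitInterval := fun y j =>
    projIcc 0 1 zero_le_one ((y j.succ + 1) / 2)
  have hs : Continuous s := by
    refine continuous_pi fun j => continuous_projIcc.comp (by fun_prop)
  have hbd : ∀ y : sphere (0 : Fin (i + 1) → ℝ) 1, |y.1 0| ≠ 1 → f (s y) = x := by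
    intro y hy
    have hy1 : ‖(y : Fin (i + 1) → ℝ)‖ = 1 := by simp
    obtain ⟨j, hj⟩ : ∃ j, |y.1 j| = 1 := by
      by_contra! hne
      refine hy1.not_lt ((pi_norm_lt_iff zero_lt_one).2 fun j => ?_)
      exact lt_of_le_of_ne ((norm_le_pi_norm _ j).trans hy1.le) (hne j)
    obtain ⟨k, rfl⟩ := Fin.exists_succ_eq.2 (show j ≠ 0 by rintro rfl; exact hy hj)
    refine f.2 _ ⟨k, ?_⟩
    rcases (abs_eq zero_le_one).1 hj with hj | hj
    · right; simp [s, hj]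
    · left; simp [s, hj]
  let g : C(sphere (0 : Fin (i + 1) → ℝ) 1, X) :=
    ⟨fun y => if y.1 0 ≤ 0 then f (s y) else x,
      Continuous.if_le (f.1.continuous.comp (hs.comp continuous_subtype_val)) continuous_const
        ((continuous_apply 0).comp continuous_subtype_val) continuous_const fun y hy => hbd y (by simp [hy])⟩
  obtain ⟨F, hF⟩ := exists_extension_of_nullhomotopic (h i hi g)
  let q : unitInterval × (Fin i → unitInterval) → Fin (i + 1) → ℝ := fun p =>
    Fin.cons (2 * (p.1 : ℝ) - 1) fun j => 2 * (p.2 j : ℝ) - 1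
  have hq : Continuous q := by
    refine continuous_pi fun j => ?_
    refine Fin.cases ?_ (fun j => ?_) j <;> simp only [q, Fin.cons_zero, Fin.cons_succ] <;> fun_prop
  have hq1 : ∀ p, ‖q p‖ ≤ 1 := by
    intro p
    rw [pi_norm_le_iff_of_nonneg zero_le_one]
    intro j
    rw [Real.norm_eq_abs, abs_le]
    refine Fin.cases ?_ (fun j => ?_) j <;> simp only [q, Fin.cons_zero, Fin.cons_succ]
    · constructor <;> linarith [p.1.2.1, p.1.2.2]
    · constructor <;> linarith [(p.2 j).2.1, (p.2 j).2.2]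
  have hqs : ∀ p, s (q p) = p.2 := by
    intro p
    ext j
    simp [s, q]
  have hq2 : ∀ p, ∀ j, |q p j| = 1 → ‖q p‖ = 1 := fun p j hj =>
    le_antisymm (hq1 p) (by rw [← hj, ← Real.norm_eq_abs]; exact norm_le_pi_norm _ _)
  let Φ : C(unitInterval × (Fin i → unitInterval), X) :=
    ⟨fun p => F ⟨q p, by simpa using hq1 p⟩, by fun_prop⟩
  have hΦ : ∀ p, (hp : ‖q p‖ = 1) → Φ p = if q p 0 ≤ 0 then f p.2 else x := by
    intro p hp
    have := hF ⟨q p, by simpa using hp⟩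
    simpa [Φ, g, hqs] using this
  refine ⟨⟨⟨Φ, fun y => ?_, fun y => ?_⟩, ?_⟩⟩
  · have h0 : q (0, y) 0 = -1 := by simp [q]
    refine (hΦ (0, y) (hq2 _ 0 (by simp [h0]))).trans ?_
    rw [h0]
    norm_num
  · have h0 : q (1, y) 0 = 1 := by norm_num [q]
    refine (hΦ (1, y) (hq2 _ 0 (by simp [h0]))).trans ?_
    rw [h0]
    norm_num
  · intro t y hy
    have hfy : f y = x := f.2 y hy
    obtain ⟨j, hj⟩ := hy
    have h1 : |q (t, y) j.succ| = 1 := by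
      rcases hj with hj | hj <;> norm_num [q, hj]
    refine (hΦ (t, y) (hq2 _ _ h1)).trans ?_
    simp only [hfy, ite_self]
    exact hfy.symm

lemma SphereNull.cConnected {c : ℕ} {X : Type} [TopologicalSpace X] [Nonempty X]
    (h : SphereNull (c + 1) X) : CConnected c X := by
  refine ⟨‹_›, fun _ => ⟨‹_›, h.joined c.succ_pos⟩, fun i _ hi x => ⟨fun a b => ?_⟩⟩
  have hi' : i < c + 1 := by omega
  induction a using Quotient.inductionOn with | _ a => ?_
  induction b using Quotient.inductionOn with | _ b => ?_
  exact Quotient.sound ((h.genLoop_homotopic_const hi' x a).trans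
    (h.genLoop_homotopic_const hi' x b).symm)

end Spheres

section Realization

variable {V : Type*}

/-- The faces of `K` not containing `τ`. -/
def del (K : Set (Finset V)) (τ : Finset V) : Set (Finset V) := {s ∈ K | ¬ τ ⊆ s}

lemma isLowerSet_del {K : Set (Finset V)} (hK : IsLowerSet K) (τ : Finset V) :
    IsLowerSet (del K τ) := fun _ _ hba ha => ⟨hK hba ha.1, fun h => ha.2 (h.trans hba)⟩

/-- The smallest of the coordinates `f v / p v`, `v ∈ τ`. -/
noncomputable def minRatio (τ : Finset V) (hτ : τ.Nonempty) (p f : V → ℝ) : ℝ :=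
  τ.inf' hτ fun v => f v / p v

lemma continuous_minRatio (τ : Finset V) (hτ : τ.Nonempty) (p : V → ℝ) :
    Continuous (minRatio τ hτ p) :=
  Continuous.finset_inf'_apply hτ fun v _ => (continuous_apply v).div_const _

section MinRatio

variable {τ : Finset V} {hτ : τ.Nonempty} {p f : V → ℝ} (hp : ∀ v ∈ τ, 0 < p v)

include hp

lemma minRatio_mul_le {v : V} (hv : v ∈ τ) : minRatio τ hτ p f * p v ≤ f v :=
  (le_div_iff₀ (hp v hv)).1 (Finset.inf'_le (fun v => f v / p v) hv)

variable (f hτ) in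
lemma exists_minRatio_mul_eq : ∃ v ∈ τ, minRatio τ hτ p f * p v = f v := by
  obtain ⟨v, hv, h⟩ := Finset.exists_mem_eq_inf' hτ fun v => f v / p v
  exact ⟨v, hv, by rw [minRatio, h, div_mul_cancel₀ _ (hp v hv).ne']⟩

lemma minRatio_nonneg (hf : ∀ v, 0 ≤ f v) : 0 ≤ minRatio τ hτ p f :=
  (Finset.le_inf'_iff _ _).2 fun v hv => div_nonneg (hf v) (hp v hv).le

lemma minRatio_pos_iff : 0 < minRatio τ hτ p f ↔ ∀ v ∈ τ, 0 < f v := by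
  rw [minRatio, Finset.lt_inf'_iff]
  refine forall₂_congr fun v hv => ?_
  rw [div_pos_iff_of_pos_right (hp v hv)]

end MinRatio

section Coordinates

variable [Fintype V]

/-- The set of vertices at which `f` is positive. -/
noncomputable def posSupport (f : V → ℝ) : Finset V := Finset.univ.filter fun v => 0 < f v

@[simp] lemma mem_posSupport {f : V → ℝ} {v : V} : v ∈ posSupport f ↔ 0 < f v := by
  simp [posSupport]

/-- The geometric realization of a family of finite sets. -/
def geom (K : Set (Finset V)) : Set (V → ℝ) :=
  {f | (∀ v, 0 ≤ f v) ∧ ∑ v, f v = 1 ∧ posSupport f ∈ K}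

lemma homotopic_of_contiguous {S : Type*} [TopologicalSpace S] {K : Set (Finset V)}
    (hK : IsLowerSet K) (g g' : C(S, geom K))
    (h : ∀ s, ∃ A ∈ K, posSupport (g s : V → ℝ) ⊆ A ∧ posSupport (g' s : V → ℝ) ⊆ A) :
    g.Homotopic g' := by
  have hmem : ∀ p : unitInterval × S,
      (1 - (p.1 : ℝ)) • (g p.2 : V → ℝ) + (p.1 : ℝ) • (g' p.2 : V → ℝ) ∈ geom K := by
    rintro ⟨t, s⟩
    obtain ⟨A, hA, h1, h2⟩ := h s
    have ht0 := t.2.1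
    have ht1 : 0 ≤ 1 - (t : ℝ) := sub_nonneg.2 t.2.2
    refine ⟨fun v => ?_, ?_, hK (fun v hv => ?_) hA⟩
    · exact add_nonneg (mul_nonneg ht1 ((g s).2.1 v)) (mul_nonneg ht0 ((g' s).2.1 v))
    · simp only [Pi.add_apply, Pi.smul_apply, smul_eq_mul, Finset.sum_add_distrib,
        ← Finset.mul_sum, (g s).2.2.1, (g' s).2.2.1]
      ring
    · by_contra hvA
      have e1 : (g s : V → ℝ) v ≤ 0 := not_lt.1 fun h => hvA (h1 (mem_posSupport.2 h))
      have e2 : (g' s : V → ℝ) v ≤ 0 := not_lt.1 fun h => hvA (h2 (mem_posSupport.2 h))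
      have hv' := mem_posSupport.1 hv
      simp only [Pi.add_apply, Pi.smul_apply, smul_eq_mul] at hv'
      nlinarith
  refine ⟨⟨⟨fun p => ⟨_, hmem p⟩, by fun_prop⟩, fun s => ?_, fun s => ?_⟩⟩
  · apply Subtype.ext
    simp
  · apply Subtype.ext
    simp

lemma geom_mono {K L : Set (Finset V)} (h : K ⊆ L) : geom K ⊆ geom L :=
  fun _ hf => ⟨hf.1, hf.2.1, h hf.2.2⟩

/-- If maps `g` into `|K|` can be pushed into the realization of a subcomplex `L` within the
faces of `K`, then null-homotopy of spheres passes from `L` to `K`. -/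
lemma nullhomotopic_of_retract {S : Type*} [TopologicalSpace S] {K L : Set (Finset V)}
    (hK : IsLowerSet K) (hLK : L ⊆ K) (g : C(S, geom K)) (r : C(S, geom L))
    (hr : ∀ s, ∃ A ∈ K, posSupport (g s : V → ℝ) ⊆ A ∧ posSupport (r s : V → ℝ) ⊆ A)
    (hnull : r.Nullhomotopic) : g.Nullhomotopic := by
  let ι : C(geom L, geom K) := ⟨Set.inclusion (geom_mono hLK), continuous_inclusion _⟩
  obtain ⟨y, hy⟩ := hnull.comp_right ι
  exact ⟨y, (homotopic_of_contiguous hK g (ι.comp r) hr).trans hy⟩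

variable [DecidableEq V]

/-- The link of `τ` in `K`. -/
def link (K : Set (Finset V)) (τ : Finset V) : Set (Finset V) := {s | Disjoint s τ ∧ s ∪ τ ∈ K}

lemma single_mem_geom {K : Set (Finset V)} {v : V} (hv : {v} ∈ K) :
    (Pi.single v 1 : V → ℝ) ∈ geom K := by
  refine ⟨fun w => ?_, by simp, ?_⟩
  · by_cases h : w = v <;> simp [h]
  · convert hv
    ext w
    by_cases h : w = v <;> simp [h]

lemma sphereNull_geom_of_cone {K : Set (Finset V)} (hK : IsLowerSet K) (h0 : ∅ ∈ K) {w : V}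
    (hw : ∀ s ∈ K, insert w s ∈ K) (n : ℕ) : SphereNull n (geom K) := by
  intro i _ g
  refine ⟨⟨_, single_mem_geom (v := w) (by simpa using hw _ h0)⟩,
    homotopic_of_contiguous hK _ _ fun s => ⟨_, hw _ (g s).2.2.2, Finset.subset_insert _ _, ?_⟩⟩
  intro v hv
  by_cases h : v = w
  · simp [h]
  · simp [h] at hv

/-- Deleting a face whose link is a cone does not change null-homotopy of spheres. -/
lemma sphereNull_of_del_of_link_cone {K : Set (Finset V)} (hK : IsLowerSet K) {τ : Finset V}
    (hτ : τ.Nonempty) {w : V} (hwτ : w ∉ τ) (hw : ∀ s ∈ K, τ ⊆ s → insert w s ∈ K) {n : ℕ}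
    (h : SphereNull n (geom (del K τ))) : SphereNull n (geom K) := by
  intro i hi g
  let t : (V → ℝ) → ℝ := minRatio τ hτ 1
  have ht : Continuous t := continuous_minRatio τ hτ 1
  have h1 : ∀ v ∈ τ, (0 : ℝ) < (1 : V → ℝ) v := fun _ _ => one_pos
  let r : (V → ℝ) → V → ℝ := fun f v =>
    f v - (if v ∈ τ then t f else 0) + if v = w then τ.card * t f else 0
  have hr : Continuous r := by
    refine continuous_pi fun v => ?_
    refine ((continuous_apply v).sub ?_).add ?_
    · split_ifs <;> fun_prop
    · split_ifs <;> fun_prop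
  have hsub : ∀ f ∈ geom K, posSupport (r f) ⊆ if τ ⊆ posSupport f then insert w (posSupport f)
      else posSupport f := by
    intro f hf v hv
    have ht0 : 0 ≤ t f := minRatio_nonneg h1 hf.1
    rw [mem_posSupport] at hv
    split_ifs with hs
    · by_cases hvw : v = w
      · simp [hvw]
      · refine Finset.mem_insert_of_mem (mem_posSupport.2 ?_)
        simp only [r, hvw, if_false] at hv
        split_ifs at hv <;> linarith
    · have ht' : t f = 0 := le_antisymm (not_lt.1 fun h => hs fun v hv => mem_posSupport.2
        ((minRatio_pos_iff h1).1 h v hv)) ht0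
      simpa [r, ht'] using hv
  have hmem : ∀ f ∈ geom K, (if τ ⊆ posSupport f then insert w (posSupport f)
      else posSupport f) ∈ K := by
    intro f hf
    split_ifs with hs
    · exact hw _ hf.2.2 hs
    · exact hf.2.2
  have hrmem : ∀ f ∈ geom K, r f ∈ geom (del K τ) := by
    intro f hf
    have ht0 : 0 ≤ t f := minRatio_nonneg h1 hf.1
    refine ⟨fun v => ?_, ?_, hK (hsub f hf) (hmem f hf), fun hτs => ?_⟩
    · have hfv := hf.1 v
      by_cases hv : v ∈ τ
      · have hle : t f * 1 ≤ f v := minRatio_mul_le h1 hv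
        have hvw : v ≠ w := by rintro rfl; exact hwτ hv
        simp only [r, hv, hvw, if_true, if_false]
        linarith
      · simp only [r, hv, if_false]
        split_ifs
        · positivity
        · linarith
    · simp only [r, Finset.sum_add_distrib, Finset.sum_sub_distrib, hf.2.1]
      simp
    · obtain ⟨v, hv, hfv⟩ := exists_minRatio_mul_eq (f := f) hτ h1
      have hvw : v ≠ w := by rintro rfl; exact hwτ hv
      have := mem_posSupport.1 (hτs hv)
      simp only [r, hv, hvw, if_true, if_false, add_zero] at this
      have hfv' : t f = f v := by simpa using hfv
      linarith
  refine nullhomotopic_of_retract hK (fun _ hs => hs.1) g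
    ⟨fun s => ⟨r (g s), hrmem _ (g s).2⟩, by fun_prop⟩ (fun s => ?_) (h i hi _)
  refine ⟨_, hmem _ (g s).2, ?_, hsub _ (g s).2⟩
  split_ifs
  · exact Finset.subset_insert _ _
  · exact subset_rfl

/-- A map into the realization missing an interior point of a maximal face can be pushed off
the interior of that face. -/
lemma nullhomotopic_of_forall_ne {S : Type*} [TopologicalSpace S] {K : Set (Finset V)}
    (hK : IsLowerSet K) {σ : Finset V} (hσ : σ.Nonempty)
    {p : V → ℝ} (hp : ∀ v ∈ σ, 0 < p v) (hp0 : ∀ v ∉ σ, p v = 0) (hp1 : ∑ v, p v = 1)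
    (g : C(S, geom K)) (hg : ∀ s, (g s : V → ℝ) ≠ p)
    (h : ∀ r : C(S, geom (del K σ)), r.Nullhomotopic) : g.Nullhomotopic := by
  let m : (V → ℝ) → ℝ := minRatio σ hσ p
  have hm : Continuous m := continuous_minRatio σ hσ p
  have hmle : ∀ f ∈ geom K, ∀ v, m f * p v ≤ f v := by
    intro f hf v
    by_cases hv : v ∈ σ
    · exact minRatio_mul_le hp hv
    · rw [hp0 v hv, mul_zero]
      exact hf.1 v
  have hm0 : ∀ f ∈ geom K, 0 ≤ m f := fun f hf => minRatio_nonneg hp hf.1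
  have hm1 : ∀ f ∈ geom K, f ≠ p → m f < 1 := by
    intro f hf hne
    by_contra! hge
    have hle : ∀ v ∈ Finset.univ, p v ≤ f v := fun v _ => by
      have hpv : 0 ≤ p v := by
        by_cases hv : v ∈ σ
        · exact (hp v hv).le
        · exact (hp0 v hv).ge
      nlinarith [hmle f hf v]
    have := (Finset.sum_eq_sum_iff_of_le hle).1 (hp1.trans hf.2.1.symm)
    exact hne (funext fun v => (this v (Finset.mem_univ v)).symm)
  let r : (V → ℝ) → V → ℝ := fun f v => (f v - m f * p v) / (1 - m f)
  have hsub : ∀ f ∈ geom K, f ≠ p → posSupport (r f) ⊆ posSupport f := by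
    intro f hf hne v hv
    have h1 := sub_pos.2 (hm1 f hf hne)
    rw [mem_posSupport] at hv ⊢
    have h2 := (div_pos_iff_of_pos_right h1).1 hv
    by_cases hvσ : v ∈ σ
    · have := mul_nonneg (hm0 f hf) (hp v hvσ).le
      linarith
    · rw [hp0 v hvσ] at h2
      linarith
  have hrmem : ∀ f ∈ geom K, f ≠ p → r f ∈ geom (del K σ) := by
    intro f hf hne
    have h1 := sub_pos.2 (hm1 f hf hne)
    refine ⟨fun v => div_nonneg (sub_nonneg.2 (hmle f hf v)) h1.le, ?_,
      hK (hsub f hf hne) hf.2.2, fun hσs => ?_⟩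
    · rw [← Finset.sum_div, Finset.sum_sub_distrib, ← Finset.mul_sum, hp1, hf.2.1, mul_one,
        div_self h1.ne']
    · obtain ⟨v, hv, hfv⟩ := exists_minRatio_mul_eq (f := f) hσ hp
      have h2 := mem_posSupport.1 (hσs hv)
      have hfv' : m f * p v = f v := hfv
      simp [r, hfv'] at h2
  refine nullhomotopic_of_retract hK (fun _ hs => hs.1) g
    ⟨fun s => ⟨r (g s), hrmem _ (g s).2 (hg s)⟩, ?_⟩
    (fun s => ⟨_, (g s).2.2.2, subset_rfl, hsub _ (g s).2 (hg s)⟩) (h _)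
  refine Continuous.subtype_mk (continuous_pi fun v => ?_) _
  have hgs : Continuous fun s => (g s : V → ℝ) := by fun_prop
  refine Continuous.div (((continuous_apply v).comp hgs).sub ((hm.comp hgs).mul_const _))
    (continuous_const.sub (hm.comp hgs)) fun s => ?_
  exact (sub_pos.2 (hm1 _ (g s).2 (hg s))).ne'

end Coordinates

end Realization

section GeneralPosition

lemma dense_compl_image_sphere {i : ℕ} {W : Type*} [Fintype W] (hi : i < Fintype.card W)
    {φ : (Fin (i + 1) → ℝ) → W → ℝ} (hφ : ContDiff ℝ 1 φ) :
    Dense (φ '' sphere (0 : Fin (i + 1) → ℝ) 1)ᶜ := by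
  let face : Fin (i + 1) × Bool → (Fin i → ℝ) → Fin (i + 1) → ℝ := fun j x =>
    j.1.insertNth (if j.2 then (1 : ℝ) else -1) x
  have hface : ∀ j, ContDiff ℝ 1 (face j) := by
    intro j
    refine contDiff_pi.2 fun k => ?_
    refine Fin.succAboveCases j.1 ?_ (fun k => ?_) k
    · simpa [face] using contDiff_const
    · simpa [face] using contDiff_apply ℝ ℝ k
  have hcover : φ '' sphere (0 : Fin (i + 1) → ℝ) 1 ⊆ ⋃ j, range (φ ∘ face j) := by
    rintro _ ⟨y, hy, rfl⟩
    have hy1 : ‖y‖ = 1 := by simpa using hy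
    obtain ⟨j, hj⟩ : ∃ j, |y j| = 1 := by
      by_contra! hne
      refine hy1.not_lt ((pi_norm_lt_iff zero_lt_one).2 fun j => ?_)
      exact lt_of_le_of_ne ((norm_le_pi_norm _ j).trans hy1.le) (hne j)
    have key : ∀ b : Bool, y j = (if b then (1 : ℝ) else -1) →
        φ y ∈ ⋃ j, range (φ ∘ face j) := fun b hb =>
      mem_iUnion.2 ⟨(j, b), j.removeNth y, congrArg φ (by
        simp only [face, ← hb]
        exact Fin.insertNth_self_removeNth j y)⟩
    rcases (abs_eq zero_le_one).1 hj with h | h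
    · exact key true (by simpa using h)
    · exact key false (by simpa using h)
  refine dense_compl_of_dimH_lt_finrank ?_
  calc dimH (φ '' sphere (0 : Fin (i + 1) → ℝ) 1) ≤ ⨆ j, dimH (range (φ ∘ face j)) :=
        (dimH_mono hcover).trans (dimH_iUnion _).le
    _ ≤ (i : ENNReal) := iSup_le fun j => by
        simpa using (hφ.comp (hface j)).dimH_range_le
    _ < _ := by simpa using hi

variable {V : Type*} [Fintype V] [DecidableEq V]

/-- The point of the affine hull of the simplex `σ` whose coordinates at the vertices of `σ` other
than `v₀` are those of `a`. -/
def affineCompletion (σ : Finset V) (v₀ : V) (a : V → ℝ) (v : V) : ℝ :=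
  if v = v₀ then 1 - ∑ w ∈ σ.erase v₀, a w else if v ∈ σ then a v else 0

section AffineCompletion

variable {σ : Finset V} {v₀ : V} (h₀ : v₀ ∈ σ)

include h₀

omit [Fintype V] in
lemma affineCompletion_of_notMem (a : V → ℝ) {v : V} (hv : v ∉ σ) :
    affineCompletion σ v₀ a v = 0 := by
  have : v ≠ v₀ := by rintro rfl; exact hv h₀
  simp [affineCompletion, this, hv]

omit h₀ [Fintype V] in
lemma affineCompletion_of_mem_erase (a : V → ℝ) {v : V} (hv : v ∈ σ.erase v₀) :
    affineCompletion σ v₀ a v = a v := by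
  rw [Finset.mem_erase] at hv
  simp [affineCompletion, hv]

lemma sum_affineCompletion (a : V → ℝ) : ∑ v, affineCompletion σ v₀ a v = 1 := by
  rw [← Finset.sum_subset (Finset.subset_univ σ)
    fun v _ hv => affineCompletion_of_notMem h₀ a hv, ← Finset.add_sum_erase _ _ h₀,
    Finset.sum_congr rfl fun v hv => affineCompletion_of_mem_erase a hv]
  simp [affineCompletion]

lemma abs_affineCompletion_sub_le {a f : V → ℝ} (hf0 : ∀ v ∉ σ, f v = 0) (hf1 : ∑ v, f v = 1)
    {ε : ℝ} (hε : 0 ≤ ε) (h : ∀ v ∈ σ.erase v₀, |a v - f v| ≤ ε) (v : V) :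
    |affineCompletion σ v₀ a v - f v| ≤ σ.card * ε := by
  have hc : (1 : ℝ) ≤ σ.card := by exact_mod_cast Finset.card_pos.2 ⟨v₀, h₀⟩
  by_cases hv₀ : v = v₀
  · subst hv₀
    have hs : f v + ∑ w ∈ σ.erase v, f w = 1 := by
      rw [Finset.add_sum_erase _ _ h₀, Finset.sum_subset (Finset.subset_univ σ)
        fun v _ hv => hf0 v hv, hf1]
    have e : affineCompletion σ v a v - f v = -∑ w ∈ σ.erase v, (a w - f w) := by
      rw [Finset.sum_sub_distrib]
      simp only [affineCompletion, if_true]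
      linarith
    rw [e, abs_neg]
    calc |∑ w ∈ σ.erase v, (a w - f w)| ≤ ∑ w ∈ σ.erase v, |a w - f w| :=
          Finset.abs_sum_le_sum_abs _ _
      _ ≤ (σ.erase v).card * ε := by
          simpa using Finset.sum_le_sum h
      _ ≤ σ.card * ε := by
          gcongr
          exact Finset.erase_subset _ _
  · by_cases hv : v ∈ σ
    · have hv' := Finset.mem_erase.2 ⟨hv₀, hv⟩
      rw [affineCompletion_of_mem_erase a hv']
      exact (h v hv').trans (le_mul_of_one_le_left hε hc)
    · rw [affineCompletion_of_notMem h₀ a hv, hf0 v hv, sub_zero, abs_zero]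
      positivity

end AffineCompletion

/-- Attaching a simplex of dimension at least `n` along its whole boundary preserves
null-homotopy of spheres of dimension `< n`. -/
lemma sphereNull_of_del_of_maximal {K : Set (Finset V)} (hK : IsLowerSet K) {σ : Finset V}
    (hmax : ∀ s ∈ K, σ ⊆ s → s = σ) {n : ℕ} (hn : n < σ.card)
    (h : SphereNull n (geom (del K σ))) : SphereNull n (geom K) := by
  intro i hi g
  have hσ : σ.Nonempty := Finset.card_pos.1 (by omega)
  obtain ⟨v₀, h₀⟩ := hσ
  have hN : (0 : ℝ) < σ.card := by exact_mod_cast Finset.card_pos.2 ⟨v₀, h₀⟩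
  set N : ℝ := (σ.card : ℝ) with hNdef
  obtain ⟨δ, hδ⟩ : ∃ δ : ℝ, δ = 1 / (4 * N) := ⟨_, rfl⟩
  have hδ0 : 0 < δ := by rw [hδ]; positivity
  have hbδ : 1 / N = 4 * δ := by rw [hδ]; field_simp
  obtain ⟨ε, hε⟩ : ∃ ε : ℝ, ε = δ / (2 * N) := ⟨_, rfl⟩
  have hε0 : 0 < ε := by rw [hε]; positivity
  have hNε : N * ε = δ / 2 := by rw [hε]; field_simp
  -- a smooth approximation of `g`
  obtain ⟨G, hG⟩ := ContinuousMap.exists_restrict_eq isClosed_sphere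
    (⟨fun s => (g s : V → ℝ), by fun_prop⟩ : C(sphere (0 : Fin (i + 1) → ℝ) 1, V → ℝ))
  have hG' : ∀ s : sphere (0 : Fin (i + 1) → ℝ) 1, G s = g s := fun s => DFunLike.congr_fun hG s
  obtain ⟨a, ha, haG, -⟩ := G.continuous.exists_contDiff_approx 1
    (ε := fun _ => ε) continuous_const fun _ => hε0
  have hag : ∀ (s : sphere (0 : Fin (i + 1) → ℝ) 1) (v : V), |a s v - (g s : V → ℝ) v| ≤ ε := by
    intro s v
    rw [← hG', ← Real.dist_eq]
    exact (dist_le_pi_dist _ _ v).trans (haG s).le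
  -- a point near the barycenter avoided by the approximation
  obtain ⟨q, hq, hqb⟩ := (dense_compl_image_sphere (W := {v // v ∈ σ.erase v₀})
    (by rw [Fintype.card_coe, Finset.card_erase_of_mem h₀]; omega)
    (φ := fun y w => a y w)
    (contDiff_pi.2 fun w => (contDiff_apply ℝ ℝ (w : V)).comp ha)).exists_dist_lt
      (fun _ => 1 / N) hε0
  let p : V → ℝ := affineCompletion σ v₀ fun v => if hv : v ∈ σ.erase v₀ then q ⟨v, hv⟩ else 0
  have hpb : ∀ v ∈ σ, 3 * δ ≤ p v := by
    intro v hv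
    have := abs_affineCompletion_sub_le h₀
      (a := fun v => if hv : v ∈ σ.erase v₀ then q ⟨v, hv⟩ else 0)
      (f := fun v => if v ∈ σ then 1 / N else 0) (fun v hv => by simp [hv])
      (by simp [← hNdef, hN.ne']) hε0.le (fun v hv => by
        have h1 := dist_le_pi_dist (fun _ => 1 / N) q ⟨v, hv⟩
        have h2 : v ∈ σ := Finset.mem_of_mem_erase hv
        rw [dist_comm, Real.dist_eq] at h1
        simp only [hv, h2, dif_pos, if_pos]
        exact h1.trans hqb.le) v
    rw [← hNdef, hNε, if_pos hv, hbδ] at this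
    have := (abs_le.1 this).1
    change _ ≤ p v - _ at this
    linarith
  -- the modified map
  let t : (V → ℝ) → ℝ := minRatio σ ⟨v₀, h₀⟩ 1
  have ht : Continuous t := continuous_minRatio _ _ _
  have h1 : ∀ v ∈ σ, (0 : ℝ) < (1 : V → ℝ) v := fun _ _ => one_pos
  have htle : ∀ f : V → ℝ, ∀ v ∈ σ, t f ≤ f v := fun f v hv => by
    have : t f * 1 ≤ f v := minRatio_mul_le h1 hv
    linarith
  let φ : (V → ℝ) → ℝ := fun f => max 0 (min 1 ((t f - δ) / δ))
  have hφ : Continuous φ := by fun_prop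
  have hφ0 : ∀ f, 0 ≤ φ f := fun f => le_max_left _ _
  have hφ1 : ∀ f, φ f ≤ 1 := fun f => max_le zero_le_one (min_le_left _ _)
  let m : sphere (0 : Fin (i + 1) → ℝ) 1 → V → ℝ := fun s v =>
    (g s : V → ℝ) v + φ (g s) * (affineCompletion σ v₀ (a s) v - (g s : V → ℝ) v)
  have hφpos : ∀ s, φ (g s) ≠ 0 → (∀ v ∈ σ, δ ≤ (g s : V → ℝ) v) ∧
      posSupport (g s : V → ℝ) = σ ∧ ∀ v, |affineCompletion σ v₀ (a s) v - (g s : V → ℝ) v| ≤ δ / 2 := by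
    intro s hs
    have hts : δ ≤ t (g s) := by
      by_contra! hlt
      exact hs (max_eq_left ((min_le_right _ _).trans (div_nonpos_of_nonpos_of_nonneg
        (by linarith) hδ0.le)))
    have hge : ∀ v ∈ σ, δ ≤ (g s : V → ℝ) v := fun v hv => hts.trans (htle _ v hv)
    have hsupp : posSupport (g s : V → ℝ) = σ := hmax _ (g s).2.2.2 fun v hv =>
      mem_posSupport.2 (hδ0.trans_le (hge v hv))
    refine ⟨hge, hsupp, fun v => ?_⟩
    rw [← hNε]
    refine abs_affineCompletion_sub_le h₀ (fun v hv => ?_) (g s).2.2.1 hε0.le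
      (fun v _ => hag s v) v
    rw [← hsupp, mem_posSupport, not_lt] at hv
    exact le_antisymm hv ((g s).2.1 v)
  have hclose : ∀ s v, |m s v - (g s : V → ℝ) v| ≤ δ / 2 := by
    intro s v
    have e : m s v - (g s : V → ℝ) v =
      φ (g s) * (affineCompletion σ v₀ (a s) v - (g s : V → ℝ) v) := by simp [m]
    rw [e, abs_mul, abs_of_nonneg (hφ0 _)]
    by_cases hs : φ (g s) = 0
    · rw [hs, zero_mul]
      positivity
    · exact (mul_le_of_le_one_left (abs_nonneg _) (hφ1 _)).trans ((hφpos s hs).2.2 v)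
  have hmsupp : ∀ s, posSupport (m s) ⊆ posSupport (g s : V → ℝ) := by
    intro s v hv
    by_cases hs : φ (g s) = 0
    · simpa [m, hs] using hv
    · obtain ⟨-, h2, -⟩ := hφpos s hs
      by_contra hv'
      have hg0 : (g s : V → ℝ) v = 0 :=
        le_antisymm (not_lt.1 fun h => hv' (mem_posSupport.2 h)) ((g s).2.1 v)
      rw [h2] at hv'
      simp [m, hg0, affineCompletion_of_notMem h₀ _ hv'] at hv
  have hmmem : ∀ s, m s ∈ geom K := by
    intro s
    refine ⟨fun v => ?_, ?_, hK (hmsupp s) (g s).2.2.2⟩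
    · by_cases hs : φ (g s) = 0
      · simpa [m, hs] using (g s).2.1 v
      · obtain ⟨h2, h3, -⟩ := hφpos s hs
        by_cases hv : v ∈ σ
        · linarith [h2 v hv, (abs_le.1 (hclose s v)).1]
        · have hg0 : (g s : V → ℝ) v = 0 := by
            rw [← h3, mem_posSupport, not_lt] at hv
            exact le_antisymm hv ((g s).2.1 v)
          simp [m, hg0, affineCompletion_of_notMem h₀ _ hv]
    · simp only [m, Finset.sum_add_distrib, ← Finset.mul_sum, Finset.sum_sub_distrib,
        sum_affineCompletion h₀, (g s).2.2.1]
      ring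
  have hmcont : Continuous m := by
    have hgs : Continuous fun s => (g s : V → ℝ) := by fun_prop
    have hac : ∀ v, Continuous fun s : sphere (0 : Fin (i + 1) → ℝ) 1 => a s v := fun v =>
      (continuous_apply v).comp (ha.continuous.comp continuous_subtype_val)
    refine continuous_pi fun v => ((continuous_apply v).comp hgs).add
      ((hφ.comp hgs).mul (Continuous.sub ?_ ((continuous_apply v).comp hgs)))
    simp only [affineCompletion]
    split_ifs
    · exact continuous_const.sub (continuous_finsetSum _ fun w _ => hac w)
    · exact hac v
    · exact continuous_const
  have hmne : ∀ s, m s ≠ p := by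
    intro s hs
    have hts : 2 * δ ≤ t (g s) := by
      refine (Finset.le_inf'_iff _ _).2 fun v hv => ?_
      have h3 := (abs_le.1 (hclose s v)).2
      have h4 := hpb v hv
      rw [hs] at h3
      simp only [Pi.one_apply, div_one]
      linarith
    have hφs : φ (g s) = 1 := by
      have : 1 ≤ (t (g s) - δ) / δ := by
        rw [le_div_iff₀ hδ0]
        linarith
      simp [φ, this]
    refine hq ⟨s, s.2, funext fun w => ?_⟩
    have h3 := congrFun hs w
    simp only [m, hφs, p, affineCompletion_of_mem_erase _ w.2] at h3
    simpa using h3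
  obtain ⟨y, hy⟩ := nullhomotopic_of_forall_ne hK ⟨v₀, h₀⟩
    (fun v hv => (by positivity : (0 : ℝ) < 3 * δ).trans_le (hpb v hv))
    (fun v hv => affineCompletion_of_notMem h₀ _ hv) (sum_affineCompletion h₀ _)
    (⟨fun s => ⟨m s, hmmem s⟩, by fun_prop⟩) hmne fun r => h i hi r
  exact ⟨y, (homotopic_of_contiguous hK g _ fun s =>
    ⟨_, (g s).2.2.2, subset_rfl, hmsupp s⟩).trans hy⟩

end GeneralPosition

end MultipleChessboard

namespace MultipleChessboard

section Decomposable

variable {V : Type*} [DecidableEq V]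

/-- A form of vertex decomposability: `Decomposable e K` is built so that it forces `K` to be
`(e - 2)`-connected. -/
inductive Decomposable : ℕ → Set (Finset V) → Prop
  | base : Decomposable 0 {∅}
  | void (e : ℕ) : Decomposable e ∅
  | cone (e : ℕ) (K : Set (Finset V)) (w : V) (h₀ : ∅ ∈ K) (hw : ∀ s ∈ K, insert w s ∈ K) :
      Decomposable e K
  | split (e : ℕ) (K : Set (Finset V)) (u : V) (hdel : Decomposable e (del K {u}))
      (hlink : Decomposable (e - 1) (link K {u})) : Decomposable e K

variable {K : Set (Finset V)} {τ : Finset V} {u : V}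

lemma del_insert_del (u : V) : del (del K (insert u τ)) τ = del K τ := by
  ext s
  simp only [del, Set.mem_ofPred_eq, and_assoc]
  exact and_congr_right fun _ =>
    ⟨fun h => h.2, fun h => ⟨fun h' => h ((Finset.subset_insert _ _).trans h'), h⟩⟩

lemma link_del_insert (hu : u ∉ τ) : link (del K (insert u τ)) τ = del (link K τ) {u} := by
  ext s
  simp only [link, del, Set.mem_ofPred_eq, and_assoc, Finset.singleton_subset_iff]
  refine and_congr_right fun _ => and_congr_right fun _ => not_congr ?_
  rw [Finset.insert_subset_iff, Finset.mem_union]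
  simp [hu]

lemma link_insert (hu : u ∉ τ) : link K (insert u τ) = link (link K τ) {u} := by
  ext s
  have e : s ∪ insert u τ = s ∪ {u} ∪ τ := by
    ext; simp
  simp only [link, Set.mem_ofPred_eq, e, Finset.disjoint_insert_right, Finset.disjoint_union_left,
    Finset.disjoint_singleton_left, Finset.disjoint_singleton_right]
  tauto

lemma sdiff_mem_link {s : Finset V} (hs : s ∈ K) (hτs : τ ⊆ s) : s \ τ ∈ link K τ :=
  ⟨Finset.sdiff_disjoint, by rwa [Finset.sdiff_union_of_subset hτs]⟩

variable [Fintype V] {n : ℕ}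

lemma sphereNull_of_del_of_link {e : ℕ} {L : Set (Finset V)} (hL : Decomposable e L)
    (hK : IsLowerSet K) (hτ : τ.Nonempty) (hlink : link K τ = L) (hn : n < τ.card + e)
    (hdel : SphereNull n (geom (del K τ))) : SphereNull n (geom K) := by
  induction hL generalizing K τ with
  | base =>
    refine sphereNull_of_del_of_maximal hK (fun s hs hτs => ?_) hn hdel
    have := sdiff_mem_link hs hτs
    rw [hlink, Set.mem_singleton_iff, Finset.sdiff_eq_empty_iff_subset] at this
    exact this.antisymm hτs
  | void e =>
    have : del K τ = K := by
      ext s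
      refine ⟨fun h => h.1, fun hs => ⟨hs, fun hτs => ?_⟩⟩
      have := sdiff_mem_link hs hτs
      rwa [hlink] at this
    rwa [this] at hdel
  | cone e L w h₀ hw =>
    subst hlink
    have hwτ : w ∉ τ := by simpa using (hw _ h₀).1
    refine sphereNull_of_del_of_link_cone hK hτ hwτ (fun s hs hτs => ?_) hdel
    have := (hw _ (sdiff_mem_link hs hτs)).2
    rwa [Finset.insert_union, Finset.sdiff_union_of_subset hτs] at this
  | split e L u _ _ ih₁ ih₂ =>
    subst hlink
    by_cases hu : u ∈ τ
    · refine ih₁ hK hτ ?_ hn hdel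
      ext s
      simp only [del, Set.mem_ofPred_eq, Finset.singleton_subset_iff]
      exact ⟨fun h => ⟨h, fun hus => Finset.disjoint_left.1 h.1 hus hu⟩, fun h => h.1⟩
    · refine ih₂ hK (Finset.insert_nonempty u τ) (link_insert hu) ?_ ?_
      · rw [Finset.card_insert_of_notMem hu]
        omega
      · exact ih₁ (isLowerSet_del hK _) hτ (link_del_insert hu) hn (by rwa [del_insert_del])

lemma Decomposable.sphereNull {e : ℕ} (h : Decomposable e K) (hK : IsLowerSet K) (hn : n < e) :
    SphereNull n (geom K) := by
  induction h with
  | base => omega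
  | void e => exact fun i _ g => (g ⟨fun _ => 1, by simp⟩).2.2.2.elim
  | cone e K w h₀ hw => exact sphereNull_geom_of_cone hK h₀ hw n
  | split e K u _ h₂ ih₁ _ =>
    refine sphereNull_of_del_of_link h₂ hK (Finset.singleton_nonempty u) rfl ?_
      (ih₁ (isLowerSet_del hK _) hn)
    rw [Finset.card_singleton]
    omega

end Decomposable

section Board

variable {m n : ℕ}

/-- The chessboard complex with row capacities `k` and column capacities `1` on the board
consisting of the cells in the list `U`. -/
def board (U : List (Fin m × Fin n)) (k : Fin n → ℕ) : Set (Finset (Fin m × Fin n)) :=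
  {A | (∀ v ∈ A, v ∈ U) ∧ IsFace m n k (fun _ => 1) A}

/-- Lower the capacity of row `r` by one. -/
def lower (k : Fin n → ℕ) (r : Fin n) (i : Fin n) : ℕ := if i = r then k i - 1 else k i

/-- The cells which can still be used once `u` is. -/
def linkCells (U : List (Fin m × Fin n)) (k : Fin n → ℕ) (u : Fin m × Fin n) :
    List (Fin m × Fin n) :=
  U.filter fun v => decide (v.1 ≠ u.1) && decide (0 < lower k u.2 v.2)

/-- Cells whose removal makes `w` the apex of a cone. -/
def obstruction (U : List (Fin m × Fin n)) (k : Fin n → ℕ) (w : Fin m × Fin n) :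
    List (Fin m × Fin n) :=
  let R := U.filter fun u => decide (u.2 = w.2) && decide (u ≠ w)
  (U.filter fun u => decide (u.1 = w.1) && decide (u ≠ w)) ++ (R ++ [w]).take (R.length + 1 - k w.2)

/-- A search for a decomposition, along cells obstructing a cheapest possible cone apex. -/
def search : ℕ → ℕ → List (Fin m × Fin n) → (Fin n → ℕ) → Bool
  | 0, _, _, _ => false
  | fuel + 1, e, U, k =>
    e == 0 || match U.argmin fun w => (obstruction U k w).length with
      | none => false
      | some w => match obstruction U k w with
        | [] => true
        | l => l.any fun u => search fuel (e - 1) (linkCells U k u) (lower k u.2) &&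
            search fuel e (U.filter (· ≠ u)) k

variable {U : List (Fin m × Fin n)} {k : Fin n → ℕ}

lemma isLowerSet_board : IsLowerSet (board U k) := fun _ _ hBA hA =>
  ⟨fun v hv => hA.1 v (hBA hv),
    fun i => (Finset.card_le_card (Finset.filter_subset_filter _ hBA)).trans (hA.2.1 i),
    fun j => (Finset.card_le_card (Finset.filter_subset_filter _ hBA)).trans (hA.2.2 j)⟩

lemma empty_mem_board : ∅ ∈ board U k := ⟨by simp, by simp [IsFace]⟩

lemma del_board (u : Fin m × Fin n) : del (board U k) {u} = board (U.filter (· ≠ u)) k := by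
  ext A
  simp only [del, board, Set.mem_ofPred_eq, Finset.singleton_subset_iff, List.mem_filter,
    decide_eq_true_eq, forall_and]
  have : u ∉ A ↔ ∀ v ∈ A, v ≠ u := ⟨fun h v hv e => h (e ▸ hv), fun h hu => h u hu rfl⟩
  rw [this]
  tauto

lemma pos_of_mem_of_isFace {l : Fin m → ℕ} {A : Finset (Fin m × Fin n)} (hA : IsFace m n k l A)
    {v : Fin m × Fin n} (hv : v ∈ A) : 0 < k v.2 :=
  (Finset.card_pos.2 ⟨v, by simp [hv]⟩).trans_le (hA.1 v.2)

lemma link_board {u : Fin m × Fin n} (hu : u ∈ U) (hk : 0 < k u.2) :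
    link (board U k) {u} = board (linkCells U k u) (lower k u.2) := by
  ext A
  simp only [link, Set.mem_ofPred_eq, Finset.disjoint_singleton_right, board, linkCells,
    List.mem_filter, Bool.and_eq_true, decide_eq_true_eq]
  have hins : A ∪ {u} = insert u A := by ext; simp
  rw [hins]
  constructor
  · rintro ⟨huA, hU, hrow, hcol⟩
    have hface : IsFace m n (lower k u.2) (fun _ => 1) A := by
      refine ⟨fun i => ?_, fun j => (Finset.card_le_card (Finset.filter_subset_filter _
        (Finset.subset_insert _ _))).trans (hcol j)⟩
      have := hrow i
      rw [Finset.filter_insert] at this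
      unfold lower
      by_cases hi : i = u.2
      · rw [if_pos hi.symm, Finset.card_insert_of_notMem (by simp [huA])] at this
        rw [if_pos hi]
        omega
      · rw [if_neg (Ne.symm hi)] at this
        rwa [if_neg hi]
    refine ⟨fun v hv => ⟨hU v (Finset.mem_insert_of_mem hv), fun hvu => huA ?_,
      pos_of_mem_of_isFace hface hv⟩, hface⟩
    have := Finset.card_le_one.1 (hcol u.1) v (by simp [hv, hvu]) u (by simp)
    rwa [← this]
  · rintro ⟨hU, hrow, hcol⟩
    have huA : u ∉ A := fun h => (hU u h).2.1 rfl
    refine ⟨huA, ?_, fun i => ?_, fun j => ?_⟩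
    · intro v hv
      rcases Finset.mem_insert.1 hv with rfl | hv
      · exact hu
      · exact (hU v hv).1
    · have := hrow i
      unfold lower at this
      rw [Finset.filter_insert]
      split_ifs with hi
      · rw [if_pos hi.symm] at this
        refine (Finset.card_insert_le _ _).trans ?_
        rw [hi] at hk
        omega
      · rwa [if_neg (Ne.symm hi)] at this
    · rw [Finset.filter_insert]
      split_ifs with hj
      · have : A.filter (fun v => v.1 = j) = ∅ := Finset.filter_eq_empty_iff.2 fun v hv h =>
          (hU v hv).2.1 (h.trans hj.symm)
        simp [this]
      · exact hcol j

lemma link_board_eq_empty {u : Fin m × Fin n} (h : ¬ (u ∈ U ∧ 0 < k u.2)) :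
    link (board U k) {u} = ∅ := by
  refine Set.eq_empty_of_forall_notMem fun A hA => h ?_
  have hu : u ∈ A ∪ {u} := by simp
  exact ⟨hA.2.1 u hu, pos_of_mem_of_isFace hA.2.2 hu⟩

lemma decomposable_link_board {e : ℕ} {u : Fin m × Fin n}
    (h : Decomposable e (board (linkCells U k u) (lower k u.2))) :
    Decomposable e (link (board U k) {u}) := by
  by_cases hu : u ∈ U ∧ 0 < k u.2
  · rwa [link_board hu.1 hu.2]
  · rw [link_board_eq_empty hu]
    exact .void e

lemma decomposable_zero_board (U : List (Fin m × Fin n)) (k : Fin n → ℕ) :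
    Decomposable 0 (board U k) := by
  induction hl : U.length using Nat.strong_induction_on generalizing U k with
  | _ l ih =>
    subst hl
    cases U with
    | nil =>
      have : board ([] : List (Fin m × Fin n)) k = {∅} := by
        ext A
        refine ⟨fun h => Finset.eq_empty_of_forall_notMem fun v hv =>
          List.not_mem_nil (h.1 v hv), ?_⟩
        rintro rfl
        exact empty_mem_board
      rw [this]
      exact .base
    | cons u U =>
      refine .split _ _ u ?_ (decomposable_link_board (ih _ ?_ _ _ rfl))
      · rw [del_board]
        refine ih _ ?_ _ _ rfl
        exact List.length_filter_lt_length_iff_exists.2 ⟨u, by simp⟩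
      · exact List.length_filter_lt_length_iff_exists.2 ⟨u, by simp⟩

lemma decomposable_board_of_obstruction_eq_nil {w : Fin m × Fin n} (hw : w ∈ U)
    (h : obstruction U k w = []) (e : ℕ) : Decomposable e (board U k) := by
  rw [obstruction, List.append_eq_nil_iff] at h
  obtain ⟨hC, hR⟩ := h
  refine .cone e _ w empty_mem_board fun A hA => ⟨fun v hv => ?_, fun i => ?_, fun j => ?_⟩
  · rcases Finset.mem_insert.1 hv with rfl | hv
    · exact hw
    · exact hA.1 v hv
  · rw [Finset.filter_insert]
    split_ifs with hi
    · subst hi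
      set R := U.filter fun u => decide (u.2 = w.2) && decide (u ≠ w) with hRdef
      have hle : R.length + 1 ≤ k w.2 := by
        rcases List.take_eq_nil_iff.1 hR with h | h
        · omega
        · simp at h
      have hsub : insert w (A.filter fun v => v.2 = w.2) ⊆ (w :: R).toFinset := by
        intro v hv
        by_cases hvw : v = w
        · simp [hvw]
        · have hv' : v ∈ A ∧ v.2 = w.2 := by simpa [hvw] using hv
          simp [hRdef, hvw, hv'.2, hA.1 v hv'.1]
      exact (Finset.card_le_card hsub).trans ((List.toFinset_card_le _).trans (by simpa using hle))
    · exact hA.2.1 i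
  · rw [Finset.filter_insert]
    split_ifs with hj
    · refine (Finset.card_le_card (t := {w}) fun v hv => ?_).trans (Finset.card_singleton w).le
      rw [Finset.mem_singleton]
      by_contra hne
      have hv' : v ∈ A ∧ v.1 = j := by simpa [hne] using hv
      have := List.filter_eq_nil_iff.1 hC v (hA.1 v hv'.1)
      simp [hne, hv'.2, hj] at this
    · exact hA.2.2 j

lemma decomposable_of_search {fuel e : ℕ} (h : search fuel e U k = true) :
    Decomposable e (board U k) := by
  induction fuel generalizing e U k with
  | zero => simp [search] at h
  | succ fuel ih =>
    rw [search, Bool.or_eq_true] at h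
    rcases h with h | h
    · rw [beq_iff_eq] at h
      subst h
      exact decomposable_zero_board U k
    · split at h
      · exact absurd h (by simp)
      · rename_i w hw
        split at h
        · rename_i hnil
          exact decomposable_board_of_obstruction_eq_nil (List.argmin_mem hw) hnil e
        · rw [List.any_eq_true] at h
          obtain ⟨u, -, hu⟩ := h
          rw [Bool.and_eq_true] at hu
          exact .split e _ u (by rw [del_board]; exact ih hu.2)
            (decomposable_link_board (ih hu.1))

lemma realization_eq_geom_board {l : Fin m → ℕ} (hl : ∀ j, l j = 1) (hU : ∀ v, v ∈ U) :
    Realization m n k l = geom (board U k) := by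
  obtain rfl : l = fun _ => 1 := funext hl
  ext f
  refine ⟨fun h => ⟨fun v => (h.1 v).1, h.2.1, fun v _ => hU v, h.2.2⟩,
    fun h => ⟨fun v => ⟨h.1 v, ?_⟩, h.2.1, h.2.2.2⟩⟩
  rw [← h.2.1]
  exact Finset.single_le_sum (fun w _ => h.1 w) (Finset.mem_univ v)

lemma cConnected_realization {c fuel : ℕ} (v : Fin m × Fin n) (hv : 0 < k v.2)
    (h : search fuel (c + 2) (List.finRange m ×ˢ List.finRange n) k = true) :
    CConnected c (Realization m n k fun _ => 1) := by
  have hU : ∀ v, v ∈ List.finRange m ×ˢ List.finRange n := fun v =>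
    List.mem_product.2 ⟨List.mem_finRange v.1, List.mem_finRange v.2⟩
  rw [realization_eq_geom_board (fun _ => rfl) hU]
  have hvb : {v} ∈ board (List.finRange m ×ˢ List.finRange n) k := by
    refine ⟨fun v _ => hU v, fun i => ?_, fun j => ?_⟩
    · rw [Finset.filter_singleton]
      split_ifs with hi
      · simpa [← hi] using Nat.succ_le_of_lt hv
      · simp
    · exact (Finset.card_filter_le _ _).trans (Finset.card_singleton v).le
  have : Nonempty (geom (board (List.finRange m ×ˢ List.finRange n) k)) :=
    ⟨⟨_, single_mem_geom hvb⟩⟩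
  exact ((decomposable_of_search h).sphereNull isLowerSet_board (by omega)).cConnected

end Board

end MultipleChessboard

theorem connectivity_of_small_delta_2_1_complexes :
    CConnected 1 ↥(Realization 3 3 (fun _ => 2) fun _ => 1) ∧
    CConnected 1 ↥(Realization 4 3 (fun _ => 2) fun _ => 1) ∧
    CConnected 2 ↥(Realization 5 3 (fun _ => 2) fun _ => 1) ∧
    CConnected 2 ↥(Realization 6 3 (fun _ => 2) fun _ => 1) := by
  refine ⟨?_, ?_, ?_, ?_⟩
  · exact MultipleChessboard.cConnected_realization (c := 1) (fuel := 40) (0, 0) two_pos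
      (by decide +kernel)
  · exact MultipleChessboard.cConnected_realization (c := 1) (fuel := 40) (0, 0) two_pos
      (by decide +kernel)
  · exact MultipleChessboard.cConnected_realization (c := 2) (fuel := 40) (0, 0) two_pos
      (by decide +kernel)
  · exact MultipleChessboard.cConnected_realization (c := 2) (fuel := 40) (0, 0) two_pos
      (by decide +kernel)
end

section
/- For every m ≥ 2 the geometric realization of the multiple chessboard complex Δ_{m,2}^{2,1(1)} is path-connected, and for every m ≥ 4 it is 1-connected (path-connected with trivial fundamental group). -/
open scoped BigOperators

open Set Topology unitInterval

section Homotopy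

variable {X : Type*} [TopologicalSpace X]

/-- Two paths with the same endpoints inside a simply connected set are homotopic. -/
theorem IsSimplyConnected.path_homotopic {s : Set X} (hs : IsSimplyConnected s) {x y : X}
    (p q : Path x y) (hp : ∀ t, p t ∈ s) (hq : ∀ t, q t ∈ s) : p.Homotopic q := by
  have := hs.simplyConnectedSpace
  have hx : x ∈ s := by simpa using hp 0
  have hy : y ∈ s := by simpa using hp 1
  let lift (r : Path x y) (hr : ∀ t, r t ∈ s) : Path (⟨x, hx⟩ : s) ⟨y, hy⟩ :=
    { toFun := fun t => ⟨r t, hr t⟩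
      source' := by simp
      target' := by simp }
  exact (SimplyConnectedSpace.paths_homotopic (lift p hp) (lift q hq)).map
    (⟨Subtype.val, continuous_subtype_val⟩ : C(s, X))

/-- A space is simply connected as soon as one can choose homotopy classes of paths from a base
point to all points in a way that is locally compatible with composition of paths. -/
theorem simplyConnectedSpace_of_locally_compatible {x₀ : X}
    (P : ∀ x, Path.Homotopic.Quotient x₀ x)
    (h : ∀ x, ∃ U ∈ 𝓝 x, ∀ y z (γ : Path y z), (∀ t, γ t ∈ U) →
      (P y).trans (.mk γ) = P z) : SimplyConnectedSpace X := by
  have key : ∀ y z (γ : Path y z), (P y).trans (.mk γ) = P z := by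
    intro y z γ
    have hQ : (P (γ 0)).trans (.mk (γ.subpath 0 1)) = P (γ 1) := by
      refine isPreconnected_univ.induction₂
        (fun s t : I => (P (γ s)).trans (.mk (γ.subpath s t)) = P (γ t))
        ?_ ?_ ?_ (mem_univ 0) (mem_univ 1)
      · intro s _
        obtain ⟨U, hU, hUP⟩ := h (γ s)
        rw [nhdsWithin_univ]
        have hlim := (tendsto_const_nhds (x := s) (f := 𝓝 s)).uIcc Filter.tendsto_id
        filter_upwards [Filter.tendsto_smallSets_iff.1 hlim _
          (γ.continuous.continuousAt.preimage_mem_nhds hU)] with t ht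
        refine hUP _ _ _ fun r => ?_
        have hr : γ.subpath s t r ∈ range (γ.subpath s t) := mem_range_self r
        rw [Path.range_subpath] at hr
        obtain ⟨w, hw, hwr⟩ := hr
        exact hwr ▸ ht hw
      · intro r s t _ _ _ hrs hst
        rw [← hst, ← hrs, Path.Homotopic.Quotient.trans_assoc,
          ← Path.Homotopic.Quotient.mk_trans]
        congr 1
        exact Path.Homotopic.Quotient.eq.2 ⟨(Path.Homotopy.subpathTransSubpath γ r s t).symm⟩
      · intro s t _ _ hst
        rw [← hst, ← Path.symm_subpath γ s t, Path.Homotopic.Quotient.mk_symm]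
        simp
    obtain ⟨γ, rfl, rfl⟩ := γ
    rw [Path.subpath_zero_one] at hQ
    exact hQ
  rw [simply_connected_iff_paths_homotopic']
  refine ⟨⟨⟨x₀⟩, fun x y => ?_⟩, fun {x y} p q => ?_⟩
  · exact ⟨((P x).symm.trans (P y)).out⟩
  · refine Path.Homotopic.Quotient.exact ?_
    have hpq := (key x y p).trans (key x y q).symm
    have := congrArg (fun r => (P x).symm.trans r) hpq
    simpa [← Path.Homotopic.Quotient.trans_assoc] using this

end Homotopy

namespace FaceRealization

variable {V : Type*} [Fintype V] {F : Finset V → Prop}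

/-- The set of vertices at which a function is positive. -/
noncomputable def supp (f : V → ℝ) : Finset V := Finset.univ.filter fun v => 0 < f v

theorem mem_supp {f : V → ℝ} {v : V} : v ∈ supp f ↔ 0 < f v := by simp [supp]

/-- The geometric realization of the family `F` of faces. -/
def space (F : Finset V → Prop) : Set (V → ℝ) :=
  {f | (∀ v, 0 ≤ f v ∧ f v ≤ 1) ∧ ∑ v, f v = 1 ∧ F (supp f)}

theorem exists_mem_supp (x : space F) : ∃ v, v ∈ supp x.1 := by
  by_contra! h
  have h0 : ∑ v, x.1 v = 0 := Finset.sum_eq_zero fun v _ =>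
    le_antisymm (not_lt.1 fun hv => h v (mem_supp.2 hv)) (x.2.1 v).1
  exact zero_ne_one (h0.symm.trans x.2.2.1)

variable [DecidableEq V]

theorem supp_single (v : V) : supp (Pi.single v (1 : ℝ)) = {v} := by
  ext w
  rcases eq_or_ne w v with rfl | h <;> simp [mem_supp, *]

theorem supp_combo {f g : V → ℝ} (hf : ∀ v, 0 ≤ f v ∧ f v ≤ 1) (hg : ∀ v, 0 ≤ g v ∧ g v ≤ 1)
    (a b : ℝ) : supp (a • f + b • g) ⊆ supp f ∪ supp g := by
  intro v hv
  rw [mem_supp] at hv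
  by_contra! h
  simp only [Finset.mem_union, mem_supp, not_or, not_lt] at h
  simp only [Pi.add_apply, Pi.smul_apply, smul_eq_mul] at hv
  rw [le_antisymm h.1 (hf v).1, le_antisymm h.2 (hg v).1] at hv
  simp at hv

theorem combo_mem_space (hF : Antitone F) {f g : V → ℝ} (hf : f ∈ space F) (hg : g ∈ space F)
    (h : F (supp f ∪ supp g)) {a b : ℝ} (ha : 0 ≤ a) (hb : 0 ≤ b) (hab : a + b = 1) :
    a • f + b • g ∈ space F := by
  refine ⟨fun v => ?_, ?_, hF (supp_combo hf.1 hg.1 a b) h⟩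
  · exact (convex_Icc (0 : ℝ) 1) (hf.1 v) (hg.1 v) ha hb hab
  · simp [Finset.sum_add_distrib, ← Finset.mul_sum, hf.2.1, hg.2.1, hab]

/-- The point of the realization given by a vertex. -/
def vertex (hV : ∀ v, F {v}) (v : V) : space F :=
  ⟨Pi.single v 1, fun w => by rcases eq_or_ne w v with rfl | h <;> simp [*], by simp,
    by rw [supp_single]; exact hV v⟩

theorem supp_vertex (hV : ∀ v, F {v}) (v : V) : supp (vertex hV v).1 = {v} := supp_single v

/-- The closed star of a vertex. -/
def star (F : Finset V → Prop) (v : V) : Set (space F) := {x | F (insert v (supp x.1))}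

theorem isSimplyConnected_star (hF : Antitone F) (hV : ∀ v, F {v}) (v : V) :
    IsSimplyConnected (star F v) := by
  rw [← IsEmbedding.subtypeVal.isSimplyConnected_image]
  have hv : vertex hV v ∈ star F v := by
    change F _
    rw [supp_vertex]
    simpa using hV v
  have hstar : StarConvex ℝ (vertex hV v).1 (Subtype.val '' star F v) := by
    rintro _ ⟨x, hx, rfl⟩ a b ha hb hab
    have hx' : F (supp (vertex hV v).1 ∪ supp x.1) := by
      rw [supp_vertex]
      exact hx
    refine ⟨⟨_, combo_mem_space hF (vertex hV v).2 x.2 hx' ha hb hab⟩, hF ?_ hx', rfl⟩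
    refine Finset.insert_subset ?_ (supp_combo (vertex hV v).2.1 x.2.1 a b)
    simp [supp_vertex]
  have := hstar.contractibleSpace ⟨_, mem_image_of_mem _ hv⟩
  exact SimplyConnectedSpace.ofContractible _

/-- The straight path between two points of a common face. -/
def segment (hF : Antitone F) (x y : space F) (h : F (supp x.1 ∪ supp y.1)) : Path x y where
  toFun t := ⟨(1 - t.1) • x.1 + t.1 • y.1,
    combo_mem_space hF x.2 y.2 h (sub_nonneg.2 t.2.2) t.2.1 (sub_add_cancel _ _)⟩
  continuous_toFun := by fun_prop
  source' := by simp
  target' := by simp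

theorem supp_segment (hF : Antitone F) (x y : space F) (h : F (supp x.1 ∪ supp y.1)) (t : I) :
    supp (segment hF x y h t).1 ⊆ supp x.1 ∪ supp y.1 :=
  supp_combo x.2.1 y.2.1 _ _

theorem segment_mem_star (hF : Antitone F) (x y : space F) (h : F (supp x.1 ∪ supp y.1)) {v : V}
    (hv : F (insert v (supp x.1 ∪ supp y.1))) (t : I) : segment hF x y h t ∈ star F v :=
  hF (Finset.insert_subset_insert v (supp_segment hF x y h t)) hv

theorem trans_mem {X : Type*} [TopologicalSpace X] {x y z : X} {s : Set X} {p : Path x y}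
    {q : Path y z} (hp : ∀ t, p t ∈ s) (hq : ∀ t, q t ∈ s) (t : I) : p.trans q t ∈ s := by
  rw [Path.trans_apply]
  split_ifs
  exacts [hp _, hq _]

theorem segment_trans_segment (hF : Antitone F) (hV : ∀ v, F {v}) (x y z : space F) (v : V)
    (h : F (insert v (supp x.1 ∪ supp y.1 ∪ supp z.1))) (hxy : F (supp x.1 ∪ supp y.1))
    (hyz : F (supp y.1 ∪ supp z.1)) (hxz : F (supp x.1 ∪ supp z.1)) :
    (Path.Homotopic.Quotient.mk (segment hF x y hxy)).trans (.mk (segment hF y z hyz)) =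
      .mk (segment hF x z hxz) := by
  rw [← Path.Homotopic.Quotient.mk_trans, Path.Homotopic.Quotient.eq]
  refine (isSimplyConnected_star hF hV v).path_homotopic _ _
    (trans_mem (segment_mem_star hF _ _ _ (hF ?_ h)) (segment_mem_star hF _ _ _ (hF ?_ h)))
    (segment_mem_star hF _ _ _ (hF ?_ h)) <;>
  · refine Finset.insert_subset_insert v ?_
    grind

theorem face_vertex_union (hF : Antitone F) (hV : ∀ v, F {v}) {v : V} {x : space F}
    (hv : v ∈ supp x.1) : F (supp (vertex hV v).1 ∪ supp x.1) := by
  rw [supp_vertex]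
  exact hF (by grind) x.2.2.2

theorem face_vertex_union_vertex (hV : ∀ v, F {v}) {u v : V} (h : F {u, v}) :
    F (supp (vertex hV u).1 ∪ supp (vertex hV v).1) := by
  rw [supp_vertex, supp_vertex]
  exact h

/-- The homotopy class of the edge between two vertices. -/
def edge (hF : Antitone F) (hV : ∀ v, F {v}) (u v : V) (h : F {u, v}) :
    Path.Homotopic.Quotient (vertex hV u) (vertex hV v) :=
  .mk (segment hF _ _ (face_vertex_union_vertex hV h))

theorem edge_trans_edge (hF : Antitone F) (hV : ∀ v, F {v}) {u v w : V} (h : F {u, v, w})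
    (huv : F {u, v}) (hvw : F {v, w}) (huw : F {u, w}) :
    (edge hF hV u v huv).trans (edge hF hV v w hvw) = edge hF hV u w huw := by
  refine segment_trans_segment hF hV _ _ _ u ?_ _ _ _
  simp only [supp_vertex]
  exact hF (by grind) h

theorem edge_self (hF : Antitone F) (hV : ∀ v, F {v}) (v : V) (h : F {v, v}) :
    edge hF hV v v h = .refl _ := by
  have := congrArg (fun r => (edge hF hV v v h).symm.trans r)
    (edge_trans_edge hF hV (by simpa using hV v) h h h)
  simpa [← Path.Homotopic.Quotient.trans_assoc] using this

theorem edge_trans_edge_swap (hF : Antitone F) (hV : ∀ v, F {v}) {u v : V}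
    (huv : F {u, v}) (hvu : F {v, u}) :
    (edge hF hV u v huv).trans (edge hF hV v u hvu) = .refl _ := by
  rw [edge_trans_edge hF hV (hF (by grind) huv) huv hvu (by simpa using hV u), edge_self]

theorem pathConnectedSpace_of_joined (hF : Antitone F) (hV : ∀ v, F {v}) (v₀ : V)
    (h : ∀ v, Joined (vertex hV v₀) (vertex hV v)) : PathConnectedSpace (space F) := by
  have hx : ∀ x, Joined (vertex hV v₀) x := fun x => by
    obtain ⟨v, hv⟩ := exists_mem_supp x
    exact (h v).trans ⟨segment hF _ _ (face_vertex_union hF hV hv)⟩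
  exact ⟨⟨vertex hV v₀⟩, fun x y => (hx x).symm.trans (hx y)⟩

/-- The realization is simply connected if there are homotopy classes of paths from a base vertex
to all vertices which are compatible with the edges. -/
theorem simplyConnectedSpace_of_compatible (hF : Antitone F) (hV : ∀ v, F {v}) (v₀ : V)
    (P : ∀ v, Path.Homotopic.Quotient (vertex hV v₀) (vertex hV v))
    (hP : ∀ u v (h : F {u, v}), (P u).trans (edge hF hV u v h) = P v) :
    SimplyConnectedSpace (space F) := by
  choose c hc using exists_mem_supp (F := F)
  have indep : ∀ (x : space F) (u v : V) (hu : u ∈ supp x.1) (hv : v ∈ supp x.1),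
      (P u).trans (.mk (segment hF _ x (face_vertex_union hF hV hu))) =
        (P v).trans (.mk (segment hF _ x (face_vertex_union hF hV hv))) := by
    intro x u v hu hv
    have huv : F {u, v} := hF (by grind) x.2.2.2
    rw [← hP u v huv, Path.Homotopic.Quotient.trans_assoc, edge,
      segment_trans_segment hF hV _ _ _ u]
    simp only [supp_vertex]
    exact hF (by grind) x.2.2.2
  refine simplyConnectedSpace_of_locally_compatible
    (fun x => (P (c x)).trans (.mk (segment hF _ x (face_vertex_union hF hV (hc x))))) ?_
  intro x
  refine ⟨{y | 0 < y.1 (c x)}, ?_, fun y z γ hγ => ?_⟩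
  · have hcont : Continuous fun y : space F => y.1 (c x) :=
      (continuous_apply _).comp continuous_subtype_val
    exact (isOpen_lt continuous_const hcont).mem_nhds (mem_supp.1 (hc x))
  · have hy : c x ∈ supp y.1 := mem_supp.2 (by simpa using hγ 0)
    have hz : c x ∈ supp z.1 := mem_supp.2 (by simpa using hγ 1)
    rw [indep y _ _ (hc y) hy, indep z _ _ (hc z) hz, Path.Homotopic.Quotient.trans_assoc,
      ← Path.Homotopic.Quotient.mk_trans]
    congr 1
    rw [Path.Homotopic.Quotient.eq]
    have hmem : ∀ (w : space F) (hw : c x ∈ supp w.1) (t : I),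
        segment hF _ w (face_vertex_union hF hV hw) t ∈ star F (c x) := by
      intro w hw t
      refine segment_mem_star hF _ _ _ ?_ t
      rw [supp_vertex]
      exact hF (by grind) w.2.2.2
    refine (isSimplyConnected_star hF hV (c x)).path_homotopic _ _
      (trans_mem (hmem y hy) fun t => ?_) (hmem z hz)
    have ht : c x ∈ supp (γ t).1 := mem_supp.2 (hγ t)
    exact hF (by grind) (γ t).2.2.2

end FaceRealization

section Chessboard

theorem antitone_isFace (m n : ℕ) (k : Fin n → ℕ) (l : Fin m → ℕ) : Antitone (IsFace m n k l) :=
  fun _ _ hAB hB =>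
    ⟨fun i => (Finset.card_le_card (Finset.filter_subset_filter _ hAB)).trans (hB.1 i),
      fun j => (Finset.card_le_card (Finset.filter_subset_filter _ hAB)).trans (hB.2 j)⟩

variable {m : ℕ}

/-- The faces of the complex with at most two rooks in the first row, and at most one rook in the
second row and in every column. -/
abbrev RookFace (m : ℕ) : Finset (Fin m × Fin 2) → Prop := IsFace m 2 ![2, 1] fun _ => 1

theorem antitone_rookFace : Antitone (RookFace m) := antitone_isFace m 2 _ _

theorem rookFace_triangle {i k j : Fin m} (hi : i ≠ j) (hk : k ≠ j) :
    RookFace m {(i, 0), (k, 0), (j, 1)} := by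
  refine ⟨fun r => ?_, fun c => ?_⟩
  · fin_cases r
    · refine (Finset.card_le_card (t := {(i, 0), (k, 0)}) fun v hv => ?_).trans Finset.card_le_two
      simp only [Finset.mem_filter, Finset.mem_insert, Finset.mem_singleton] at hv ⊢
      rcases hv with ⟨rfl | rfl | rfl, h⟩ <;> simp at h ⊢
    · refine (Finset.card_le_card (t := {(j, 1)}) fun v hv => ?_).trans
        (Finset.card_singleton _).le
      simp only [Finset.mem_filter, Finset.mem_insert, Finset.mem_singleton] at hv ⊢
      rcases hv with ⟨rfl | rfl | rfl, h⟩ <;> simp at h ⊢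
  · rw [Finset.card_le_one]
    intro v hv w hw
    simp only [Finset.mem_filter, Finset.mem_insert, Finset.mem_singleton] at hv hw
    grind

theorem eq_of_rookFace_second_row {i j : Fin m} (h : RookFace m {(i, 1), (j, 1)}) : i = j := by
  have := Finset.card_le_one.1 (h.1 1) (i, 1) (by simp) (j, 1) (by simp)
  simpa using this

theorem ne_of_rookFace {i j : Fin m} (h : RookFace m {(i, 0), (j, 1)}) : i ≠ j := by
  rintro rfl
  have := Finset.card_le_one.1 (h.2 i) (i, 0) (by simp) (i, 1) (by simp)
  simp at this

theorem rookFace_edge {i j : Fin m} (h : i ≠ j) : RookFace m {(i, 0), (j, 1)} :=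
  antitone_rookFace (by grind) (rookFace_triangle h h)

theorem rookFace_first_row (i k : Fin m) : RookFace m {(i, 0), (k, 0)} := by
  refine ⟨fun r => ?_, fun c => ?_⟩
  · fin_cases r
    · exact (Finset.card_filter_le _ _).trans Finset.card_le_two
    · simp [Finset.filter_insert, Finset.filter_singleton]
  · rw [Finset.card_le_one]
    intro v hv w hw
    simp only [Finset.mem_filter, Finset.mem_insert, Finset.mem_singleton] at hv hw
    grind

section Nontrivial

variable [Nontrivial (Fin m)]

theorem rookFace_singleton (v : Fin m × Fin 2) : RookFace m {v} := by
  obtain ⟨i, r⟩ := v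
  obtain ⟨j, hj⟩ := exists_ne i
  fin_cases r
  · exact antitone_rookFace (by simp) (rookFace_first_row i i)
  · exact antitone_rookFace (by simp) (rookFace_edge hj)

/-- The edge between two vertices of the complex, as a homotopy class of paths. -/
abbrev rookEdge (u v : Fin m × Fin 2) (h : RookFace m {u, v}) :=
  FaceRealization.edge antitone_rookFace rookFace_singleton u v h

/-- A homotopy class of edge paths from a vertex in the first row to each vertex. -/
noncomputable def rookClass (i : Fin m) : ∀ v : Fin m × Fin 2, Path.Homotopic.Quotient
    (FaceRealization.vertex rookFace_singleton (i, 0))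
    (FaceRealization.vertex rookFace_singleton v)
  | (k, 0) => rookEdge (i, 0) (k, 0) (rookFace_first_row i k)
  | (j, 1) => (rookEdge (i, 0) ((exists_ne j).choose, 0) (rookFace_first_row _ _)).trans
      (rookEdge _ (j, 1) (rookFace_edge (exists_ne j).choose_spec))

theorem rookEdge_eq_trans {i k j : Fin m} (hi : i ≠ j) (hk : k ≠ j) :
    rookEdge (i, 0) (k, 0) (rookFace_first_row i k) =
      (rookEdge (i, 0) (j, 1) (rookFace_edge hi)).trans
        (rookEdge (j, 1) (k, 0) (by rw [Finset.pair_comm]; exact rookFace_edge hk)) := by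
  rw [FaceRealization.edge_trans_edge]
  exact antitone_rookFace (by grind) (rookFace_triangle hi hk)

theorem rookEdge_trans_first_row (hm : 4 ≤ m) (i k l : Fin m) :
    (rookEdge (i, 0) (k, 0) (rookFace_first_row i k)).trans
      (rookEdge (k, 0) (l, 0) (rookFace_first_row k l)) =
      rookEdge (i, 0) (l, 0) (rookFace_first_row i l) := by
  obtain ⟨j, hj⟩ : ∃ j, j ∉ ({i, k, l} : Finset (Fin m)) := by
    by_contra! h
    have h3 : ({i, k, l} : Finset (Fin m)).card ≤ 3 := Finset.card_le_three
    rw [Finset.eq_univ_of_forall h, Finset.card_univ, Fintype.card_fin] at h3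
    omega
  simp only [Finset.mem_insert, Finset.mem_singleton, not_or] at hj
  have hi : i ≠ j := Ne.symm hj.1
  have hk : k ≠ j := Ne.symm hj.2.1
  have hl : l ≠ j := Ne.symm hj.2.2
  rw [rookEdge_eq_trans hi hk, rookEdge_eq_trans hk hl, rookEdge_eq_trans hi hl,
    Path.Homotopic.Quotient.trans_assoc]
  congr 1
  rw [← Path.Homotopic.Quotient.trans_assoc, FaceRealization.edge_trans_edge_swap,
    Path.Homotopic.Quotient.refl_trans]

theorem rookClass_trans_edge (hm : 4 ≤ m) (i : Fin m) :
    ∀ (u v : Fin m × Fin 2) (h : RookFace m {u, v}),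
      (rookClass i u).trans (rookEdge u v h) = rookClass i v := by
  have down : ∀ (k j : Fin m) (h : RookFace m {(k, 0), (j, 1)}),
      (rookClass i (k, 0)).trans (rookEdge (k, 0) (j, 1) h) = rookClass i (j, 1) := by
    intro k j h
    have hj := (exists_ne j).choose_spec
    simp only [rookClass]
    rw [← rookEdge_trans_first_row hm i k (exists_ne j).choose, Path.Homotopic.Quotient.trans_assoc]
    congr 1
    rw [FaceRealization.edge_trans_edge]
    exact rookFace_triangle (ne_of_rookFace h) hj
  simp only [Prod.forall, Fin.forall_fin_two]
  refine fun k => ⟨fun l => ⟨fun h => ?_, fun h => down k l h⟩, fun l => ⟨fun h => ?_, fun h => ?_⟩⟩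
  · exact rookEdge_trans_first_row hm i k l
  · rw [← down l k (by rwa [Finset.pair_comm]), Path.Homotopic.Quotient.trans_assoc,
      FaceRealization.edge_trans_edge_swap, Path.Homotopic.Quotient.trans_refl]
  · obtain rfl := eq_of_rookFace_second_row h
    rw [rookEdge, FaceRealization.edge_self, Path.Homotopic.Quotient.trans_refl]

end Nontrivial

end Chessboard

theorem connectivity_of_delta_m_2_2_1_1 (m : ℕ) :
    (2 ≤ m → PathConnectedSpace ↥(Realization m 2 ![2, 1] fun _ => 1)) ∧
    (4 ≤ m → SimplyConnectedSpace ↥(Realization m 2 ![2, 1] fun _ => 1)) := by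
  refine ⟨fun hm => ?_, fun hm => ?_⟩
  all_goals
    have : Nontrivial (Fin m) := Fin.nontrivial_iff_two_le.2 (by omega)
    let i : Fin m := ⟨0, by omega⟩
  · exact FaceRealization.pathConnectedSpace_of_joined antitone_rookFace rookFace_singleton
      (i, 0) fun v => ⟨(rookClass i v).out⟩
  · exact FaceRealization.simplyConnectedSpace_of_compatible antitone_rookFace rookFace_singleton
      (i, 0) (rookClass i) (rookClass_trans_edge hm i)
end

section
/- The geometric realization of the multiple chessboard complex Δ_{4,2}^{2,1(1)} (a 4×2 chessboard with at most 2 rooks in the first row, at most one rook in the second row and at most one rook in each column) is homeomorphic to the sphere S^2. -/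
open scoped BigOperators

/-- The second smallest entry of a vector with four entries. -/
noncomputable def secondSmallest (y : Fin 4 → ℝ) : ℝ :=
  (Finset.univ : Finset (Fin 4)).offDiag.inf' (Finset.card_pos.1 (by decide)) fun p => max (y p.1) (y p.2)

theorem continuous_secondSmallest : Continuous secondSmallest := by
  unfold secondSmallest
  exact Continuous.finset_inf'_apply _ fun p _ => by fun_prop

theorem le_secondSmallest {c : ℝ} {y : Fin 4 → ℝ} :
    c ≤ secondSmallest y ↔ ∀ i j, i ≠ j → c ≤ y i ∨ c ≤ y j := by
  rw [secondSmallest, Finset.le_inf'_iff]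
  simp

theorem secondSmallest_le {c : ℝ} {y : Fin 4 → ℝ} :
    secondSmallest y ≤ c ↔ ∃ i j, i ≠ j ∧ y i ≤ c ∧ y j ≤ c := by
  rw [secondSmallest, Finset.inf'_le_iff]
  simp

theorem secondSmallest_sub_const (y : Fin 4 → ℝ) (c : ℝ) :
    secondSmallest (fun i => y i - c) = secondSmallest y - c := by
  refine eq_of_forall_le_iff fun d => ?_
  rw [le_sub_iff_add_le, le_secondSmallest, le_secondSmallest]
  simp only [le_sub_iff_add_le]

theorem secondSmallest_smul {t : ℝ} (ht : 0 < t) (y : Fin 4 → ℝ) :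
    secondSmallest (t • y) = t * secondSmallest y := by
  refine eq_of_forall_le_iff fun d => ?_
  rw [← div_le_iff₀' ht, le_secondSmallest, le_secondSmallest]
  simp only [Pi.smul_apply, smul_eq_mul, div_le_iff₀' ht]

theorem secondSmallest_const (c : ℝ) : secondSmallest (fun _ => c) = c :=
  le_antisymm (secondSmallest_le.2 ⟨0, 1, by decide, le_rfl, le_rfl⟩)
    (le_secondSmallest.2 fun _ _ _ => Or.inl le_rfl)

theorem secondSmallest_eq_zero_iff (y : Fin 4 → ℝ) :
    secondSmallest y = 0 ↔ (Finset.univ.filter fun i => 0 < y i).card ≤ 2 ∧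
      (Finset.univ.filter fun i => y i < 0).card ≤ 1 := by
  rw [le_antisymm_iff]
  refine and_congr ?_ ?_
  · have h := Finset.card_filter_add_card_filter_not (s := Finset.univ) (fun i => 0 < y i)
    rw [Finset.card_univ, Fintype.card_fin] at h
    have h2 : (Finset.univ.filter fun i => 0 < y i).card ≤ 2 ↔
        1 < (Finset.univ.filter fun i => ¬ 0 < y i).card := by omega
    rw [h2, secondSmallest_le, Finset.one_lt_card]
    simp only [Finset.mem_filter, Finset.mem_univ, true_and, not_lt]
    tauto
  · rw [le_secondSmallest, Finset.card_le_one]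
    simp only [Finset.mem_filter, Finset.mem_univ, true_and]
    refine forall_congr' fun i => ⟨fun h hi j hj => ?_, fun h j hij => ?_⟩
    · by_contra hij
      rcases h j hij with h | h <;> linarith
    · by_contra! hc
      exact hij (h hc.1 j hc.2)

theorem card_filter_row {m n : ℕ} (f : Fin m × Fin n → ℝ) (i : Fin n) :
    ((Finset.univ.filter fun v => 0 < f v).filter fun v => v.2 = i).card =
      (Finset.univ.filter fun j => 0 < f (j, i)).card := by
  refine (Finset.card_bij (fun j _ => (j, i)) ?_ ?_ ?_).symm
  · simp
  · simp
  · rintro ⟨a, b⟩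
    simp only [Finset.mem_filter, Finset.mem_univ, true_and]
    rintro ⟨h, rfl⟩
    exact ⟨a, h, rfl⟩

theorem card_filter_column {m n : ℕ} (f : Fin m × Fin n → ℝ) (j : Fin m) :
    ((Finset.univ.filter fun v => 0 < f v).filter fun v => v.1 = j).card =
      (Finset.univ.filter fun i => 0 < f (j, i)).card := by
  refine (Finset.card_bij (fun i _ => (j, i)) ?_ ?_ ?_).symm
  · simp
  · simp
  · rintro ⟨a, b⟩
    simp only [Finset.mem_filter, Finset.mem_univ, true_and]
    rintro ⟨h, rfl⟩
    exact ⟨b, h, rfl⟩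

theorem isFace_support_iff (f : Fin 4 × Fin 2 → ℝ) (hf : ∀ v, 0 ≤ f v) :
    IsFace 4 2 ![2, 1] (fun _ => 1) (Finset.univ.filter fun v => 0 < f v) ↔
      secondSmallest (fun i => f (i, 0) - f (i, 1)) = 0 ∧ ∀ i, f (i, 0) = 0 ∨ f (i, 1) = 0 := by
  have hcol : (∀ j, (Finset.univ.filter fun i => 0 < f (j, i)).card ≤ 1) ↔
      ∀ j, f (j, 0) = 0 ∨ f (j, 1) = 0 := by
    refine forall_congr' fun j => ?_
    rw [Finset.card_filter, Fin.sum_univ_two]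
    have h0 := hf (j, 0)
    have h1 := hf (j, 1)
    split_ifs with h h' h' <;> simp <;> grind
  simp only [IsFace, card_filter_row, card_filter_column, hcol, Fin.forall_fin_two,
    Matrix.cons_val_zero, Matrix.cons_val_one]
  refine and_congr_left fun h => ?_
  rw [secondSmallest_eq_zero_iff]
  have hpos : ∀ i, 0 < f (i, 0) ↔ 0 < f (i, 0) - f (i, 1) := fun i => by
    have := hf (i, 0)
    have := hf (i, 1)
    rcases h i with h | h <;> grind
  have hneg : ∀ i, 0 < f (i, 1) ↔ f (i, 0) - f (i, 1) < 0 := fun i => by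
    have := hf (i, 0)
    have := hf (i, 1)
    rcases h i with h | h <;> grind
  simp only [← hpos, ← hneg]

/-- The unit sphere for the sum norm in the set of vectors with second smallest entry zero. -/
def SecondSmallestSphere : Set (Fin 4 → ℝ) :=
  {y | secondSmallest y = 0 ∧ ∑ i, |y i| = 1}

/-- Rooks in the first row become positive entries, those in the second row negative entries. -/
noncomputable def realizationHomeo :
    Realization 4 2 ![2, 1] (fun _ => 1) ≃ₜ SecondSmallestSphere where
  toFun f := ⟨fun i => f.1 (i, 0) - f.1 (i, 1), by
    obtain ⟨f, h01, hsum, hface⟩ := f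
    obtain ⟨hs, hcol⟩ := (isFace_support_iff f fun v => (h01 v).1).1 hface
    refine ⟨hs, ?_⟩
    refine (Finset.sum_congr rfl fun i _ => ?_).trans ((Fintype.sum_prod_type f).symm.trans hsum)
    have h0 := (h01 (i, 0)).1
    have h1 := (h01 (i, 1)).1
    rw [Fin.sum_univ_two]
    rcases hcol i with h | h <;> simp [h, abs_of_nonneg, h0, h1]⟩
  invFun y := ⟨fun v => if v.2 = 0 then max (y.1 v.1) 0 else max (-y.1 v.1) 0, by
    obtain ⟨y, hs, hsum⟩ := y
    have hle : ∀ i, |y i| ≤ 1 := fun i =>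
      hsum ▸ Finset.single_le_sum (f := fun i => |y i|) (fun _ _ => abs_nonneg _)
        (Finset.mem_univ i)
    have hnonneg : ∀ v : Fin 4 × Fin 2,
        0 ≤ if v.2 = 0 then max (y v.1) 0 else max (-y v.1) 0 := fun v => by
      split_ifs <;> exact le_max_right _ _
    refine ⟨fun v => ⟨hnonneg v, ?_⟩, ?_, (isFace_support_iff _ hnonneg).2 ⟨?_, ?_⟩⟩
    · have := abs_le.1 (hle v.1)
      dsimp only
      split_ifs <;> exact max_le (by linarith) zero_le_one
    · refine Eq.trans ?_ hsum
      rw [Fintype.sum_prod_type]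
      refine Finset.sum_congr rfl fun i _ => ?_
      rw [Fin.sum_univ_two]
      simp
    · simpa using (congrArg secondSmallest
        (funext fun i => max_zero_sub_max_neg_zero_eq_self (y i))).trans hs
    · intro i
      rcases le_total (y i) 0 with h | h <;> simp [h]⟩
  left_inv f := by
    obtain ⟨f, h01, hsum, hface⟩ := f
    obtain ⟨hs, hcol⟩ := (isFace_support_iff f fun v => (h01 v).1).1 hface
    ext ⟨i, k⟩
    have h0 := (h01 (i, 0)).1
    have h1 := (h01 (i, 1)).1
    fin_cases k <;> rcases hcol i with h | h <;> simp [h, h0, h1]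
  right_inv y := by
    ext i
    simp
  continuous_toFun := by
    have h (v : Fin 4 × Fin 2) := (continuous_apply v).comp
      (continuous_subtype_val (p := (· ∈ Realization 4 2 ![2, 1] fun _ => 1)))
    exact Continuous.subtype_mk (continuous_pi fun i => (h (i, 0)).sub (h (i, 1))) _
  continuous_invFun := by
    have h (i : Fin 4) := (continuous_apply i).comp
      (continuous_subtype_val (p := (· ∈ SecondSmallestSphere)))
    refine Continuous.subtype_mk (continuous_pi fun v => ?_) _
    split_ifs
    · exact (h v.1).max continuous_const
    · exact (h v.1).neg.max continuous_const

/-- The differences of the first three entries with the last one. -/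
noncomputable def differences (y : Fin 4 → ℝ) : EuclideanSpace ℝ (Fin 3) :=
  WithLp.toLp 2 fun i => y i.castSucc - y 3

/-- The vector with second smallest entry zero and prescribed differences. -/
noncomputable def ofDifferences (z : EuclideanSpace ℝ (Fin 3)) : Fin 4 → ℝ :=
  fun i => (Fin.snoc z.ofLp 0 : Fin 4 → ℝ) i - secondSmallest (Fin.snoc z.ofLp 0)

theorem continuous_differences : Continuous differences := by
  unfold differences
  fun_prop

theorem continuous_ofDifferences : Continuous ofDifferences := by
  have h : Continuous fun z : EuclideanSpace ℝ (Fin 3) => (Fin.snoc z.ofLp 0 : Fin 4 → ℝ) := by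
    fun_prop
  exact continuous_pi fun i =>
    ((continuous_apply i).comp h).sub (continuous_secondSmallest.comp h)

theorem secondSmallest_ofDifferences (z : EuclideanSpace ℝ (Fin 3)) :
    secondSmallest (ofDifferences z) = 0 := by
  unfold ofDifferences
  rw [secondSmallest_sub_const, sub_self]

theorem differences_smul (t : ℝ) (y : Fin 4 → ℝ) :
    differences (t • y) = t • differences y := by
  ext i
  simp [differences, mul_sub]

theorem differences_ofDifferences (z : EuclideanSpace ℝ (Fin 3)) :
    differences (ofDifferences z) = z := by
  ext i
  have h : (Fin.snoc z.ofLp 0 : Fin 4 → ℝ) 3 = 0 := Fin.snoc_last (α := fun _ => ℝ) _ _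
  simp [differences, ofDifferences, h]

theorem ofDifferences_differences {y : Fin 4 → ℝ} (hy : secondSmallest y = 0) :
    ofDifferences (differences y) = y := by
  have h : (Fin.snoc (differences y).ofLp 0 : Fin 4 → ℝ) = fun i => y i - y 3 := by
    funext i
    refine Fin.lastCases ?_ (fun i => ?_) i
    · rw [Fin.snoc_last]
      exact (sub_self _).symm
    · simp [differences]
  unfold ofDifferences
  rw [h, secondSmallest_sub_const, hy]
  simp

theorem ofDifferences_smul {t : ℝ} (ht : 0 < t) (z : EuclideanSpace ℝ (Fin 3)) :
    ofDifferences (t • z) = t • ofDifferences z := by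
  have h : secondSmallest (t • ofDifferences z) = 0 := by
    rw [secondSmallest_smul ht, secondSmallest_ofDifferences, mul_zero]
  rw [← ofDifferences_differences h, differences_smul, differences_ofDifferences]

theorem differences_zero : differences 0 = 0 := by
  ext i
  simp [differences]

theorem ofDifferences_zero : ofDifferences 0 = 0 := by
  have h := ofDifferences_differences (y := 0) (secondSmallest_const 0)
  rwa [differences_zero] at h

theorem norm_differences_pos {y : Fin 4 → ℝ} (hy : y ∈ SecondSmallestSphere) :
    0 < ‖differences y‖ := by
  rw [norm_pos_iff]
  intro h
  have h0 := ofDifferences_differences hy.1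
  rw [h, ofDifferences_zero] at h0
  have h1 := hy.2
  simp [← h0] at h1

theorem sum_abs_ofDifferences_pos {z : EuclideanSpace ℝ (Fin 3)}
    (hz : z ∈ Metric.sphere (0 : EuclideanSpace ℝ (Fin 3)) 1) :
    0 < ∑ i, |ofDifferences z i| := by
  refine (Finset.sum_nonneg fun _ _ => abs_nonneg _).lt_of_ne' fun h => ?_
  have h0 : ofDifferences z = 0 := funext fun i => abs_eq_zero.1
    ((Finset.sum_eq_zero_iff_of_nonneg fun _ _ => abs_nonneg _).1 h i (Finset.mem_univ i))
  have h1 := differences_ofDifferences z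
  rw [h0, differences_zero] at h1
  simp [← h1] at hz

/-- Radial projection identifies the two unit spheres. -/
noncomputable def secondSmallestSphereHomeo :
    SecondSmallestSphere ≃ₜ Metric.sphere (0 : EuclideanSpace ℝ (Fin 3)) 1 where
  toFun y := ⟨‖differences y.1‖⁻¹ • differences y.1, by
    rw [mem_sphere_zero_iff_norm, norm_smul, norm_inv, norm_norm,
      inv_mul_cancel₀ (norm_differences_pos y.2).ne']⟩
  invFun z := ⟨(∑ i, |ofDifferences z.1 i|)⁻¹ • ofDifferences z.1, by
    have h := sum_abs_ofDifferences_pos z.2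
    refine ⟨?_, ?_⟩
    · rw [secondSmallest_smul (inv_pos.2 h), secondSmallest_ofDifferences, mul_zero]
    · simp only [Pi.smul_apply, smul_eq_mul, abs_mul, ← Finset.mul_sum,
        abs_of_pos (inv_pos.2 h)]
      exact inv_mul_cancel₀ h.ne'⟩
  left_inv y := by
    have h := norm_differences_pos y.2
    apply Subtype.ext
    dsimp only
    rw [ofDifferences_smul (inv_pos.2 h), ofDifferences_differences y.2.1]
    simp only [Pi.smul_apply, smul_eq_mul, abs_mul, ← Finset.mul_sum,
      abs_of_pos (inv_pos.2 h), y.2.2, mul_one, inv_inv]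
    rw [smul_smul, mul_inv_cancel₀ h.ne', one_smul]
  right_inv z := by
    have h := sum_abs_ofDifferences_pos z.2
    apply Subtype.ext
    dsimp only
    rw [differences_smul, differences_ofDifferences, norm_smul, norm_eq_of_mem_sphere z, mul_one,
      Real.norm_of_nonneg (inv_pos.2 h).le, inv_inv, smul_smul, mul_inv_cancel₀ h.ne', one_smul]
  continuous_toFun := by
    have h := continuous_differences.comp
      (continuous_subtype_val (p := (· ∈ SecondSmallestSphere)))
    exact ((h.norm.inv₀ fun y => (norm_differences_pos y.2).ne').smul h).subtype_mk _
  continuous_invFun := by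
    have h := continuous_ofDifferences.comp
      (continuous_subtype_val (p := (· ∈ Metric.sphere (0 : EuclideanSpace ℝ (Fin 3)) 1)))
    have hsum := continuous_finsetSum Finset.univ fun i _ => ((continuous_apply i).comp h).abs
    exact ((hsum.inv₀ fun z => (sum_abs_ofDifferences_pos z.2).ne').smul h).subtype_mk _

theorem delta_4_2_2_1_1_is_S2 :
    Nonempty (↥(Realization 4 2 ![2, 1] fun _ => 1) ≃ₜ
      Metric.sphere (0 : EuclideanSpace ℝ (Fin 3)) 1) :=
  ⟨realizationHomeo.trans secondSmallestSphereHomeo⟩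
end

section
/- For all integers n ≥ 1 and 1 ≤ p ≤ m − 1, the geometric realization of the multiple chessboard complex Δ_{m,n}^{p,n} (at most p rooks in each of the n rows and at most n rooks in each of the m columns, i.e. no effective column restriction) is (np − 2)-connected. -/
open scoped BigOperators

open Set Module in
/-- General position: a continuous map into a vector space can be changed, away from a compact
set on which it already avoids `B`, so as to avoid `B` everywhere, provided `B` is contained in
finitely many subspaces of codimension larger than the dimension of the source. -/
theorem exists_continuousMap_eqOn_notMem {E V ι : Type*} [Finite ι]
    [NormedAddCommGroup E] [NormedSpace ℝ E] [FiniteDimensional ℝ E]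
    [NormedAddCommGroup V] [NormedSpace ℝ V] [FiniteDimensional ℝ V]
    (L : ι → Submodule ℝ V) (hL : ∀ i, finrank ℝ E + finrank ℝ (L i) < finrank ℝ V)
    {B : Set V} (hB : IsClosed B) (hBL : B ⊆ ⋃ i, (L i : Set V))
    {A : Set E} (hA : IsCompact A) (Φ : C(E, V)) (hΦ : ∀ a ∈ A, Φ a ∉ B) :
    ∃ G : C(E, V), EqOn G Φ A ∧ ∀ q, G q ∉ B := by
  rcases B.eq_empty_or_nonempty with rfl | hBne
  · exact ⟨Φ, fun _ _ => rfl, fun _ => notMem_empty _⟩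
  have hδc : Continuous fun q => Metric.infDist (Φ q) B :=
    (Metric.continuous_infDist_pt B).comp Φ.continuous
  obtain ⟨ε, hε, hεA⟩ : ∃ ε > 0, ∀ a ∈ A, 2 * ε ≤ Metric.infDist (Φ a) B := by
    obtain ⟨c, hc, hcA⟩ := hA.exists_forall_le' hδc.continuousOn
      (a := 0) fun a ha => (hB.notMem_iff_infDist_pos hBne).1 (hΦ a ha)
    exact ⟨c / 2, by positivity, fun a ha => by linarith [hcA a ha]⟩
  obtain ⟨ψ, hψ, hψΦ, -⟩ := Φ.continuous.exists_contDiff_approx 1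
    (ε := fun _ => ε / 2) continuous_const fun _ => by positivity
  have hdim : dimH (⋃ i, range fun x : E × L i => (x.2 : V) - ψ x.1) < finrank ℝ V := by
    have hle (i : ι) : dimH (range fun x : E × L i => (x.2 : V) - ψ x.1) ≤
        ((finrank ℝ V - 1 : ℕ) : ENNReal) := by
      have hsmooth : ContDiff ℝ 1 fun x : E × L i => (x.2 : V) - ψ x.1 :=
        ((L i).subtypeL.contDiff.comp contDiff_snd).sub (hψ.comp contDiff_fst)
      refine hsmooth.dimH_range_le.trans ?_
      rw [finrank_prod]
      exact_mod_cast Nat.le_sub_one_of_lt (hL i)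
    rw [dimH_iUnion]
    refine (iSup_le hle).trans_lt ?_
    obtain ⟨b, hb⟩ := hBne
    obtain ⟨i, -⟩ := mem_iUnion.1 (hBL hb)
    have := hL i
    exact_mod_cast (by omega : finrank ℝ V - 1 < finrank ℝ V)
  obtain ⟨v, hv, hvε⟩ := (dense_compl_of_dimH_lt_finrank hdim).exists_dist_lt 0 (half_pos hε)
  rw [dist_zero_left] at hvε
  have hψB (q : E) : ψ q + v ∉ B := fun hq => by
    obtain ⟨i, hi⟩ := mem_iUnion.1 (hBL hq)
    exact hv (mem_iUnion.2 ⟨i, (q, ⟨_, hi⟩), by simp⟩)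
  have hψε (q : E) : ‖ψ q + v - Φ q‖ < ε := by
    have h := hψΦ q
    rw [dist_eq_norm] at h
    calc ‖ψ q + v - Φ q‖ = ‖(ψ q - Φ q) + v‖ := by congr 1; abel
      _ ≤ ‖ψ q - Φ q‖ + ‖v‖ := norm_add_le _ _
      _ < ε := by linarith
  let η : E → ℝ := fun q => max 0 (min 1 ((Metric.infDist (Φ q) B - ε) / ε))
  have hηc : Continuous η := by fun_prop
  have hη0 (q : E) : 0 ≤ η q := le_max_left _ _
  have hη1 (q : E) : η q ≤ 1 := max_le zero_le_one (min_le_left _ _)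
  have hψc := hψ.continuous
  refine ⟨⟨fun q => Φ q + (1 - η q) • (ψ q + v - Φ q), by fun_prop⟩, fun a ha => ?_, fun q => ?_⟩
  · have hη : η a = 1 := by
      have : 1 ≤ (Metric.infDist (Φ a) B - ε) / ε := by
        rw [le_div_iff₀ hε]; linarith [hεA a ha]
      simp [η, this]
    simp [hη]
  · simp only [ContinuousMap.coe_mk]
    rcases le_or_gt (Metric.infDist (Φ q) B) ε with hq | hq
    · have hη : η q = 0 :=
        max_eq_left ((min_le_right _ _).trans
          (div_nonpos_of_nonpos_of_nonneg (by linarith) hε.le))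
      simpa [hη] using hψB q
    · intro hmem
      have h := Metric.infDist_le_dist_of_mem (x := Φ q) hmem
      rw [dist_self_add_right, norm_smul, Real.norm_of_nonneg (by linarith [hη1 q])] at h
      nlinarith [hη0 q, hη1 q, hψε q, norm_nonneg (ψ q + v - Φ q)]

open unitInterval in
/-- A subset of a vector space in which all extension problems from compact subsets of the cube
of dimension `i + 1` that are solvable in the ambient space can be solved has trivial `i`-th
homotopy group. -/
theorem subsingleton_homotopyGroup_of_extension {V : Type*} [NormedAddCommGroup V]
    [NormedSpace ℝ V] {X : Set V} {i : ℕ}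
    (h : ∀ A : Set (ℝ × (Fin i → ℝ)), IsCompact A → ∀ Φ : C(ℝ × (Fin i → ℝ), V),
      (∀ a ∈ A, Φ a ∈ X) → ∃ G : C(ℝ × (Fin i → ℝ), X), ∀ a ∈ A, (G a : V) = Φ a) (x : X) :
    Subsingleton (HomotopyGroup (Fin i) X x) := by
  suffices ∀ f : GenLoop (Fin i) X x, GenLoop.Homotopic f GenLoop.const from
    ⟨fun a b => Quotient.inductionOn₂ a b fun f g =>
      Quotient.sound ((this f).trans (this g).symm)⟩
  intro f
  let proj : (Fin i → ℝ) → (Fin i → I) := fun y k => Set.projIcc 0 1 zero_le_one (y k)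
  have hproj : Continuous proj :=
    continuous_pi fun k => continuous_projIcc.comp (continuous_apply k)
  let incl : I × (Fin i → I) → ℝ × (Fin i → ℝ) := fun q => (q.1, fun k => q.2 k)
  have hincl : Continuous incl := by fun_prop
  have hproj_incl (q : I × (Fin i → I)) : proj (incl q).2 = q.2 :=
    funext fun k => Set.projIcc_val zero_le_one (q.2 k)
  have hfc : Continuous f := f.1.continuous
  let Φ : C(ℝ × (Fin i → ℝ), V) :=
    ⟨fun q => (1 - q.1) • (f (proj q.2) : V) + q.1 • (x : V), by fun_prop⟩
  have hΦ (q : I × (Fin i → I)) :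
      Φ (incl q) = (1 - (q.1 : ℝ)) • (f q.2 : V) + (q.1 : ℝ) • (x : V) := by
    simp [Φ, hproj_incl, incl]
  let S : Set (I × (Fin i → I)) := {q | q.1 = 0 ∨ q.1 = 1 ∨ q.2 ∈ Cube.boundary (Fin i)}
  have hbdry : IsClosed (Cube.boundary (Fin i)) := by
    have : Cube.boundary (Fin i) = ⋃ k, ({y | y k = 0} ∪ {y | y k = 1}) := by
      ext y; simp [Cube.boundary]
    rw [this]
    exact isClosed_iUnion_of_finite fun k =>
      (isClosed_eq (continuous_apply k) continuous_const).union
        (isClosed_eq (continuous_apply k) continuous_const)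
  have hS : IsClosed S :=
    (isClosed_eq continuous_fst continuous_const).union
      ((isClosed_eq continuous_fst continuous_const).union (hbdry.preimage continuous_snd))
  have hΦ0 (y : Fin i → I) : Φ (incl (0, y)) = f y := by simp [hΦ]
  have hΦ1 (y : Fin i → I) : Φ (incl (1, y)) = x := by simp [hΦ]
  have hΦb (t : I) (y : Fin i → I) (hy : y ∈ Cube.boundary (Fin i)) :
      Φ (incl (t, y)) = x := by
    simp [hΦ, show f y = x from f.2 y hy, ← add_smul]
  obtain ⟨G, hG⟩ := h (incl '' S) (hS.isCompact.image hincl) Φ <| by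
    rintro _ ⟨⟨t, y⟩, rfl | rfl | hy, rfl⟩
    · rw [hΦ0]; exact (f y).2
    · rw [hΦ1]; exact x.2
    · rw [hΦb t y hy]; exact x.2
  have hG' (q : I × (Fin i → I)) (hq : q ∈ S) : (G (incl q) : V) = Φ (incl q) :=
    hG _ (Set.mem_image_of_mem incl hq)
  refine ⟨⟨⟨⟨fun q => G (incl q), by fun_prop⟩, fun y => ?_, fun y => ?_⟩, fun t y hy => ?_⟩⟩
  · exact Subtype.ext ((hG' (0, y) (Or.inl rfl)).trans (hΦ0 y))
  · exact Subtype.ext ((hG' (1, y) (Or.inr (Or.inl rfl))).trans (hΦ1 y))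
  · exact (Subtype.ext ((hG' (t, y) (Or.inr (Or.inr hy))).trans (hΦb t y hy))).trans
      (f.2 y hy).symm

/-- A nonempty subset of a vector space in which two points can be joined whenever a continuous
curve in the ambient space can be pushed into the subset is path-connected. -/
theorem pathConnectedSpace_of_extension {V : Type*} [NormedAddCommGroup V]
    [NormedSpace ℝ V] {X : Set V} (hX : X.Nonempty)
    (h : ∀ A : Set ℝ, IsCompact A → ∀ Φ : C(ℝ, V),
      (∀ a ∈ A, Φ a ∈ X) → ∃ G : C(ℝ, X), ∀ a ∈ A, (G a : V) = Φ a) :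
    PathConnectedSpace X := by
  refine ⟨hX.to_subtype, fun x y => ?_⟩
  let Φ : C(ℝ, V) := ⟨fun t => (1 - t) • (x : V) + t • (y : V), by fun_prop⟩
  have hΦ0 : Φ 0 = x := by simp [Φ]
  have hΦ1 : Φ 1 = y := by simp [Φ]
  obtain ⟨G, hG⟩ := h {0, 1} (Set.toFinite _).isCompact Φ <| by
    rintro _ (rfl | rfl)
    · rw [hΦ0]; exact x.2
    · rw [hΦ1]; exact y.2
  exact ⟨⟨⟨fun t => G t, by fun_prop⟩,
    Subtype.ext (by simpa using (hG 0 (by simp)).trans hΦ0),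
    Subtype.ext (by simpa using (hG 1 (by simp)).trans hΦ1)⟩⟩

/-- The `(p + 1)`-st largest value of `f`. -/
noncomputable def succNthLargest {α : Type*} [Fintype α] (p : ℕ) [Nonempty (Fin (p + 1) ↪ α)]
    (f : α → ℝ) : ℝ :=
  letI := Fintype.ofFinite (Fin (p + 1) ↪ α)
  Finset.univ.sup' Finset.univ_nonempty fun e : Fin (p + 1) ↪ α =>
    Finset.univ.inf' Finset.univ_nonempty fun k => f (e k)

section succNthLargest

variable {α : Type*} [Fintype α] {p : ℕ} [Nonempty (Fin (p + 1) ↪ α)]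

@[fun_prop]
theorem continuous_succNthLargest : Continuous (succNthLargest p : (α → ℝ) → ℝ) := by
  unfold succNthLargest
  exact Continuous.finset_sup'_apply _ fun e _ =>
    Continuous.finset_inf'_apply _ fun k _ => continuous_apply (e k)

theorem exists_succNthLargest_le (f : α → ℝ) (e : Fin (p + 1) ↪ α) :
    ∃ k, f (e k) ≤ succNthLargest p f := by
  let := Fintype.ofFinite (Fin (p + 1) ↪ α)
  obtain ⟨k, -, hk⟩ := Finset.univ.exists_mem_eq_inf' Finset.univ_nonempty fun k => f (e k)
  refine ⟨k, hk.symm.le.trans ?_⟩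
  exact Finset.le_sup' (fun e : Fin (p + 1) ↪ α =>
    Finset.univ.inf' Finset.univ_nonempty fun k => f (e k)) (Finset.mem_univ e)

theorem exists_forall_succNthLargest_le (f : α → ℝ) :
    ∃ e : Fin (p + 1) ↪ α, (∀ k, succNthLargest p f ≤ f (e k)) ∧
      ∃ k, f (e k) = succNthLargest p f := by
  let := Fintype.ofFinite (Fin (p + 1) ↪ α)
  obtain ⟨e, -, he⟩ := Finset.univ.exists_mem_eq_sup' Finset.univ_nonempty
    fun e : Fin (p + 1) ↪ α => Finset.univ.inf' Finset.univ_nonempty fun k => f (e k)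
  obtain ⟨k, -, hk⟩ := Finset.univ.exists_mem_eq_inf' Finset.univ_nonempty fun k => f (e k)
  have he' : succNthLargest p f = Finset.univ.inf' Finset.univ_nonempty fun k => f (e k) := he
  exact ⟨e, fun k => he'.le.trans (Finset.inf'_le _ (Finset.mem_univ k)), k, (he'.trans hk).symm⟩

/-- At most `p` values exceed the `(p + 1)`-st largest one. -/
theorem card_succNthLargest_lt_le (f : α → ℝ) :
    (Finset.univ.filter fun a => succNthLargest p f < f a).card ≤ p := by
  by_contra! hlt
  obtain ⟨s, hs, hcard⟩ := Finset.exists_subset_card_eq (Nat.succ_le_of_lt hlt)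
  obtain ⟨k, hk⟩ := exists_succNthLargest_le f
    ((s.equivFinOfCardEq hcard).symm.toEmbedding.trans (Function.Embedding.subtype _))
  exact hk.not_gt (Finset.mem_filter.1 (hs ((s.equivFinOfCardEq hcard).symm k).2)).2

theorem succNthLargest_eq_zero {f : α → ℝ} (hf : ∀ a, 0 ≤ f a)
    (hcard : (Finset.univ.filter fun a => 0 < f a).card ≤ p) : succNthLargest p f = 0 := by
  obtain ⟨e, he, k, hk⟩ := exists_forall_succNthLargest_le (p := p) f
  refine le_antisymm (not_lt.1 fun hpos => ?_) (hk ▸ hf _)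
  have := Finset.card_le_card_of_injOn (s := Finset.univ)
    (t := Finset.univ.filter fun a => 0 < f a) e
    (fun k _ => by simpa using hpos.trans_le (he k)) e.injective.injOn
  simp at this
  omega

end succNthLargest

section truncation

variable {m n p : ℕ}

/-- The differences between the entries of `f` at the positions selected by `σ` in a row and the
entry at the first selected position of that row. -/
def rowDifferences (σ : Fin n → Fin (p + 1) ↪ Fin m) :
    (Fin m × Fin n → ℝ) →ₗ[ℝ] (Fin n × Fin p → ℝ) where
  toFun f x := f (σ x.1 x.2.succ, x.1) - f (σ x.1 0, x.1)
  map_add' f g := by ext; simp; ring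
  map_smul' c f := by ext; simp; ring

theorem finrank_ker_rowDifferences (σ : Fin n → Fin (p + 1) ↪ Fin m) :
    n * p + Module.finrank ℝ (LinearMap.ker (rowDifferences σ)) = m * n := by
  let pos : Fin n × Fin p → Fin m × Fin n := fun x => (σ x.1 x.2.succ, x.1)
  have hpos : Function.Injective pos := by
    rintro ⟨i, k⟩ ⟨i', k'⟩ h
    obtain rfl : i = i' := congrArg Prod.snd h
    have : σ i k.succ = σ i k'.succ := congrArg Prod.fst h
    simpa using this
  have hsurj : Function.Surjective (rowDifferences σ) := fun g => by
    refine ⟨Function.extend pos g 0, funext fun x => ?_⟩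
    have h0 : ¬ ∃ y, pos y = (σ x.1 0, x.1) := by
      rintro ⟨y, hy⟩
      have h2 : y.1 = x.1 := congrArg Prod.snd hy
      have h1 : σ y.1 y.2.succ = σ x.1 0 := congrArg Prod.fst hy
      rw [h2] at h1
      exact Fin.succ_ne_zero _ ((σ x.1).injective h1)
    change Function.extend pos g 0 (pos x) - Function.extend pos g 0 (σ x.1 0, x.1) = g x
    rw [hpos.extend_apply, Function.extend_apply' _ _ _ h0]
    simp
  have h := LinearMap.finrank_range_add_finrank_ker (rowDifferences σ)
  rw [LinearMap.range_eq_top.2 hsurj, finrank_top] at h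
  simpa using h

variable [Nonempty (Fin (p + 1) ↪ Fin m)]

/-- The excess of each entry over the `(p + 1)`-st largest entry of its row. -/
noncomputable def rowTruncation (p : ℕ) [Nonempty (Fin (p + 1) ↪ Fin m)]
    (f : Fin m × Fin n → ℝ) (v : Fin m × Fin n) : ℝ :=
  max 0 (f v - succNthLargest p fun j => f (j, v.2))

theorem continuous_rowTruncation :
    Continuous (rowTruncation p : (Fin m × Fin n → ℝ) → Fin m × Fin n → ℝ) := by
  unfold rowTruncation
  fun_prop

theorem rowTruncation_nonneg (f : Fin m × Fin n → ℝ) (v : Fin m × Fin n) :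
    0 ≤ rowTruncation p f v :=
  le_max_left _ _

theorem sum_rowTruncation_nonneg (f : Fin m × Fin n → ℝ) : 0 ≤ ∑ v, rowTruncation p f v :=
  Finset.sum_nonneg fun v _ => rowTruncation_nonneg f v

theorem rowTruncation_eq_self {l : Fin m → ℕ} {f : Fin m × Fin n → ℝ}
    (hf : f ∈ Realization m n (fun _ => p) l) : rowTruncation p f = f := by
  obtain ⟨h01, -, hrow, -⟩ := hf
  ext ⟨j, i⟩
  have : succNthLargest p (fun j => f (j, i)) = 0 := by
    refine succNthLargest_eq_zero (fun j => (h01 _).1) (le_trans ?_ (hrow i))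
    exact Finset.card_le_card_of_injOn (fun j => (j, i)) (fun j hj => by simpa using hj)
      fun j _ j' _ h => congrArg Prod.fst h
  simp [rowTruncation, this, (h01 (j, i)).1]

theorem smul_rowTruncation_mem_realization {f : Fin m × Fin n → ℝ}
    (hf : ∑ v, rowTruncation p f v ≠ 0) :
    (∑ v, rowTruncation p f v)⁻¹ • rowTruncation p f ∈
      Realization m n (fun _ => p) fun _ => n := by
  have hpos : 0 < ∑ v, rowTruncation p f v := (sum_rowTruncation_nonneg f).lt_of_ne' hf
  refine ⟨fun v => ⟨?_, ?_⟩, ?_, fun i => ?_, fun j => ?_⟩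
  · exact mul_nonneg (inv_nonneg.2 hpos.le) (rowTruncation_nonneg f v)
  · rw [Pi.smul_apply, smul_eq_mul, inv_mul_le_one₀ hpos]
    exact Finset.single_le_sum (fun v _ => rowTruncation_nonneg f v) (Finset.mem_univ v)
  · simp only [Pi.smul_apply, smul_eq_mul, ← Finset.mul_sum]
    exact inv_mul_cancel₀ hf
  · refine le_trans ?_ (card_succNthLargest_lt_le (p := p) fun j => f (j, i))
    refine Finset.card_le_card_of_injOn Prod.fst (fun v hv => ?_) fun v hv w hw h => ?_
    · obtain ⟨hpv, rfl⟩ : 0 < (∑ v, rowTruncation p f v)⁻¹ * rowTruncation p f v ∧ v.2 = i := by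
        simpa using hv
      have := pos_of_mul_pos_right hpv (inv_nonneg.2 hpos.le)
      simpa [rowTruncation] using this
    · simp only [Finset.coe_filter, Set.mem_ofPred_eq] at hv hw
      exact Prod.ext h (hv.2.trans hw.2.symm)
  · refine (Finset.card_le_card_of_injOn (t := Finset.univ) Prod.snd (fun v _ => by simp)
      fun v hv w hw h => ?_).trans (Finset.card_fin n).le
    simp only [Finset.coe_filter, Set.mem_ofPred_eq] at hv hw
    exact Prod.ext (hv.2.trans hw.2.symm) h

theorem exists_mem_ker_rowDifferences {f : Fin m × Fin n → ℝ}
    (hf : ∑ v, rowTruncation p f v = 0) :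
    ∃ σ : Fin n → Fin (p + 1) ↪ Fin m, f ∈ LinearMap.ker (rowDifferences σ) := by
  have hle (v : Fin m × Fin n) : f v ≤ succNthLargest p fun j => f (j, v.2) := by
    have := (Finset.sum_eq_zero_iff_of_nonneg fun v _ => rowTruncation_nonneg f v).1 hf v
      (Finset.mem_univ v)
    simpa [rowTruncation] using this
  choose σ hσ _ using fun i : Fin n => exists_forall_succNthLargest_le (p := p) fun j => f (j, i)
  have heq (i : Fin n) (k : Fin (p + 1)) :
      f (σ i k, i) = succNthLargest p fun j => f (j, i) :=
    le_antisymm (hle (σ i k, i)) (hσ i k)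
  refine ⟨σ, LinearMap.mem_ker.2 (funext fun x => ?_)⟩
  simp [rowDifferences, heq]

/-- The realization has the extension property for maps from spaces of dimension less than
`n * p`. -/
theorem realization_extension {E : Type*} [NormedAddCommGroup E]
    [NormedSpace ℝ E] [FiniteDimensional ℝ E] (hE : Module.finrank ℝ E < n * p)
    (A : Set E) (hA : IsCompact A) (Φ : C(E, Fin m × Fin n → ℝ))
    (hΦ : ∀ a ∈ A, Φ a ∈ Realization m n (fun _ => p) fun _ => n) :
    ∃ G : C(E, Realization m n (fun _ => p) fun _ => n),
      ∀ a ∈ A, (G a : Fin m × Fin n → ℝ) = Φ a := by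
  have hcont := continuous_rowTruncation (m := m) (n := n) (p := p)
  have hsum : Continuous fun f : Fin m × Fin n → ℝ => ∑ v, rowTruncation p f v := by fun_prop
  have hΦsum (a : E) (ha : a ∈ A) : ∑ v, rowTruncation p (Φ a) v = 1 := by
    rw [rowTruncation_eq_self (hΦ a ha)]; exact (hΦ a ha).2.1
  obtain ⟨G, hGΦ, hG⟩ := exists_continuousMap_eqOn_notMem
    (fun σ : Fin n → Fin (p + 1) ↪ Fin m => LinearMap.ker (rowDifferences σ))
    (fun σ => by
      have := finrank_ker_rowDifferences σ
      simp only [Module.finrank_fintype_fun_eq_card, Fintype.card_prod, Fintype.card_fin]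
      omega)
    (B := {f | ∑ v, rowTruncation p f v = 0}) (isClosed_eq hsum continuous_const)
    (fun f hf => Set.mem_iUnion.2 (exists_mem_ker_rowDifferences hf)) hA Φ
    (fun a ha h => one_ne_zero ((hΦsum a ha).symm.trans h))
  refine ⟨⟨fun q => ⟨_, smul_rowTruncation_mem_realization (hG q)⟩, ?_⟩, fun a ha => ?_⟩
  · exact (((hsum.comp G.continuous).inv₀ hG).smul (hcont.comp G.continuous)).subtype_mk _
  · simp only [ContinuousMap.coe_mk]
    rw [hGΦ ha, hΦsum a ha, rowTruncation_eq_self (hΦ a ha), inv_one, one_smul]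

end truncation

theorem connectivity_of_delta_m_n_p_n (m n p : ℕ) (hn : 1 ≤ n) (hp : 1 ≤ p)
    (hpm : p ≤ m - 1) :
    CConnected ((n : ℤ) * p - 2) ↥(Realization m n (fun _ => p) fun _ => n) := by
  have : Nonempty (Fin (p + 1) ↪ Fin m) := ⟨Fin.castLEEmb (by omega)⟩
  have hne : (Realization m n (fun _ => p) fun _ => n).Nonempty := by
    let v₀ : Fin m × Fin n := (⟨0, by omega⟩, ⟨0, hn⟩)
    have hsupp : (Finset.univ.filter fun v => 0 < (Pi.single v₀ 1 : Fin m × Fin n → ℝ) v) =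
        {v₀} := by
      ext v
      by_cases hv : v = v₀ <;> simp [hv]
    refine ⟨Pi.single v₀ 1, fun v => ?_, by simp, ?_⟩
    · by_cases hv : v = v₀ <;> simp [hv]
    · rw [hsupp]
      exact ⟨fun i => (Finset.card_filter_le _ _).trans (by simpa using hp),
        fun j => (Finset.card_filter_le _ _).trans (by simpa using hn)⟩
  refine ⟨hne.to_subtype, fun h => ?_, fun i _ hi x => ?_⟩
  · refine pathConnectedSpace_of_extension hne (realization_extension ?_)
    rw [Module.finrank_self]
    zify
    linarith
  · refine subsingleton_homotopyGroup_of_extension (realization_extension ?_) x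
    rw [Module.finrank_prod, Module.finrank_self, Module.finrank_fin_fun]
    zify
    linarith
end
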